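/- arXiv:1604.01422 — 7 statements merged into one kernel-verified Lean document; each statement's English description precedes it below -/
import Mathlib

section
/- For all δ>0 there exists Δ₀=Δ₀(δ) such that for every finite graph G=(V,E) with maximum degree Δ≥Δ₀ and every 0<λ<(1−δ)·λ_c(Δ), the belief-propagation operator F : [0,1]^V → [0,1]^V has a unique fixed point ω*. -/
open scoped BigOperators

noncomputable section

namespace HardCore

/-- The critical fugacity `λ_c(Δ) = (Δ-1)^(Δ-1) / (Δ-2)^Δ`. -/
def lambdaC (D : ℕ) : ℝ := ((D : ℝ) - 1) ^ (D - 1) / ((D : ℝ) - 2) ^ D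

variable {V : Type} [Fintype V] [DecidableEq V]

/-- The belief-propagation operator `F(ω)(v) = ∏_{u ∈ N(v)} 1/(1 + λ·ω(u))`. -/
def bpF (G : SimpleGraph V) [DecidableRel G.Adj] (lam : ℝ) (ω : V → ℝ) : V → ℝ :=
  fun v => ∏ u ∈ G.neighborFinset v, (1 + lam * ω u)⁻¹

end HardCore

open HardCore

namespace HardCore

/-- The product `∏_{u ∈ s} (1 + λ·w(u)²)^(-1/2)`: the belief-propagation update in the variable
`w = √ω`. -/
def sqrtBP {V : Type} (lam : ℝ) (s : Finset V) (w : V → ℝ) : ℝ :=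
  Real.exp (-(1 / 2 * ∑ u ∈ s, Real.log (1 + lam * w u ^ 2)))

lemma sqrtBP_sq {V : Type} {lam : ℝ} (hlam : 0 ≤ lam) (s : Finset V) (w : V → ℝ) :
    sqrtBP lam s w ^ 2 = ∏ u ∈ s, (1 + lam * w u ^ 2)⁻¹ := by
  have hpos : ∀ u, 0 < 1 + lam * w u ^ 2 := fun u => by positivity
  rw [sqrtBP, ← Real.exp_nat_mul, Finset.prod_inv_distrib,
    ← Real.exp_log (Finset.prod_pos fun u (_ : u ∈ s) => hpos u), ← Real.exp_neg,
    Real.log_prod fun u _ => (hpos u).ne']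
  congr 1
  push_cast
  ring

lemma sq_sum_div_le {V : Type} {lam : ℝ} (hlam : 0 < lam) (s : Finset V) (w : V → ℝ) :
    (∑ u ∈ s, lam * |w u| / (1 + lam * w u ^ 2)) ^ 2 ≤
      lam * s.card * ∑ u ∈ s, Real.log (1 + lam * w u ^ 2) := by
  refine sq_sum_le_card_mul_sum_sq.trans ?_
  rw [mul_comm lam (s.card : ℝ), mul_assoc, Finset.mul_sum s _ lam]
  gcongr with u _
  have hpos : 0 < 1 + lam * w u ^ 2 := by positivity
  have hlog := Real.one_sub_inv_le_log_of_pos hpos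
  refine le_trans ?_ (mul_le_mul_of_nonneg_left hlog hlam.le)
  have hone : 1 ≤ 1 + lam * w u ^ 2 := by nlinarith [sq_nonneg (w u)]
  have heq : lam * (1 - (1 + lam * w u ^ 2)⁻¹) = lam ^ 2 * w u ^ 2 / (1 + lam * w u ^ 2) := by
    field_simp
    ring
  rw [heq, div_pow, mul_pow, sq_abs]
  exact div_le_div_of_nonneg_left (by positivity) hpos (by nlinarith)

lemma sqrtBP_mul_sum_div_le {V : Type} {lam : ℝ} (hlam : 0 < lam) (s : Finset V) (w : V → ℝ) :
    sqrtBP lam s w * ∑ u ∈ s, lam * |w u| / (1 + lam * w u ^ 2) ≤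
      √(lam * s.card * Real.exp (-1)) := by
  refine Real.le_sqrt_of_sq_le ?_
  rw [mul_pow]
  refine (mul_le_mul_of_nonneg_left (sq_sum_div_le hlam s w) (sq_nonneg _)).trans ?_
  rw [sqrtBP, ← Real.exp_nat_mul]
  set L := ∑ u ∈ s, Real.log (1 + lam * w u ^ 2)
  have hL : L * Real.exp (-L) ≤ Real.exp (-1) := by
    have h := Real.add_one_le_exp (L - 1)
    have h' := mul_le_mul_of_nonneg_right h (Real.exp_pos (-L)).le
    rw [← Real.exp_add] at h'
    ring_nf at h' ⊢
    exact h'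
  have hexp : ((2 : ℕ) : ℝ) * -(1 / 2 * L) = -L := by
    push_cast
    ring
  rw [hexp]
  calc Real.exp (-L) * (lam * s.card * L) = lam * s.card * (L * Real.exp (-L)) := by ring
    _ ≤ _ := mul_le_mul_of_nonneg_left hL (by positivity)

lemma abs_sqrtBP_sub_le {V : Type} [Fintype V] {lam : ℝ} (hlam : 0 < lam) (s : Finset V) (x y : V → ℝ) :
    |sqrtBP lam s y - sqrtBP lam s x| ≤ √(lam * s.card * Real.exp (-1)) * ‖y - x‖ := by
  let z : ℝ → V → ℝ := fun t u => x u + t * (y u - x u)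
  have hz : ∀ t u, HasDerivAt (fun t => z t u) (y u - x u) t := fun t u => by
    simpa [z] using ((hasDerivAt_id t).mul_const (y u - x u)).const_add (x u)
  have hderiv : ∀ t, HasDerivAt (fun t => sqrtBP lam s (z t))
      (sqrtBP lam s (z t) *
        -∑ u ∈ s, lam * z t u / (1 + lam * z t u ^ 2) * (y u - x u)) t := by
    intro t
    have hlog : ∀ u ∈ s, HasDerivAt (fun t => Real.log (1 + lam * z t u ^ 2))
        (2 * (lam * z t u / (1 + lam * z t u ^ 2) * (y u - x u))) t := by
      intro u _
      have hpos : 0 < 1 + lam * z t u ^ 2 := by positivity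
      refine (((((hz t u).fun_pow 2).const_mul lam).const_add 1).log hpos.ne').congr_deriv ?_
      push_cast
      ring
    refine ((HasDerivAt.fun_sum hlog).const_mul (1 / 2)).fun_neg.exp.congr_deriv ?_
    rw [← Finset.mul_sum, sqrtBP]
    ring
  have hbound : ∀ t, ‖sqrtBP lam s (z t) *
      -∑ u ∈ s, lam * z t u / (1 + lam * z t u ^ 2) * (y u - x u)‖ ≤
        √(lam * s.card * Real.exp (-1)) * ‖y - x‖ := by
    intro t
    have hpos : 0 < sqrtBP lam s (z t) := Real.exp_pos _
    rw [norm_mul, norm_neg, Real.norm_of_nonneg hpos.le]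
    refine le_trans ?_ (mul_le_mul_of_nonneg_right (sqrtBP_mul_sum_div_le hlam s (z t))
      (norm_nonneg _))
    rw [mul_assoc, Finset.sum_mul]
    refine mul_le_mul_of_nonneg_left (norm_sum_le_of_le _ fun u _ => ?_) hpos.le
    have hden : 0 < 1 + lam * z t u ^ 2 := by positivity
    rw [norm_mul, norm_div, norm_mul, Real.norm_of_nonneg hden.le, Real.norm_of_nonneg hlam.le,
      Real.norm_eq_abs (z t u)]
    exact mul_le_mul_of_nonneg_left (norm_le_pi_norm (y - x) u) (by positivity)
  have hmvt := convex_univ.norm_image_sub_le_of_norm_hasDerivWithin_le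
    (fun t _ => (hderiv t).hasDerivWithinAt) (fun t _ => hbound t)
    (Set.mem_univ 0) (Set.mem_univ 1)
  simpa [z] using hmvt

/-- Below `e / Δ` the belief-propagation operator, in the variable `√ω`, is a contraction. -/
lemma contractingWith_sqrtBP {V : Type} [Fintype V] [DecidableEq V] (G : SimpleGraph V) [DecidableRel G.Adj] {lam : ℝ} (hlam : 0 < lam)
    (h : lam * G.maxDegree < Real.exp 1) :
    ContractingWith (Real.toNNReal √(lam * G.maxDegree * Real.exp (-1)))
      (fun w : V → ℝ => fun v => sqrtBP lam (G.neighborFinset v) w) := by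
  refine ⟨?_, LipschitzWith.of_dist_le_mul fun x y => ?_⟩
  · rw [Real.toNNReal_lt_one, Real.sqrt_lt' one_pos, Real.exp_neg, one_pow, ← div_eq_mul_inv,
      div_lt_one (Real.exp_pos 1)]
    exact h
  · rw [Real.coe_toNNReal _ (Real.sqrt_nonneg _)]
    refine (dist_pi_le_iff (by positivity)).2 fun v => ?_
    rw [Real.dist_eq, dist_eq_norm]
    refine (abs_sqrtBP_sub_le hlam _ y x).trans ?_
    gcongr
    rw [SimpleGraph.card_neighborFinset_eq_degree]
    exact G.degree_le_maxDegree v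

lemma existsUnique_bpF_eq {V : Type} [Fintype V] [DecidableEq V] (G : SimpleGraph V) [DecidableRel G.Adj] {lam : ℝ} (hlam : 0 < lam)
    (h : lam * G.maxDegree < Real.exp 1) :
    ∃! ω : V → ℝ, (∀ v : V, ω v ∈ Set.Icc (0 : ℝ) 1) ∧ bpF G lam ω = ω := by
  have hc := contractingWith_sqrtBP G hlam h
  set w := hc.fixedPoint
  have hw : ∀ v, sqrtBP lam (G.neighborFinset v) w = w v :=
    congrFun hc.fixedPoint_isFixedPt
  refine ⟨fun v => w v ^ 2, ⟨fun v => ⟨sq_nonneg _, ?_⟩, ?_⟩, ?_⟩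
  · change w v ^ 2 ≤ 1
    rw [← hw, sqrtBP_sq hlam.le]
    exact Finset.prod_le_one (fun u _ => by positivity)
      fun u _ => inv_le_one_of_one_le₀ (le_add_of_nonneg_right (by positivity))
  · funext v
    rw [bpF, ← sqrtBP_sq hlam.le, hw]
  · rintro ω ⟨hmem, hfix⟩
    have hsq : ∀ u, √(ω u) ^ 2 = ω u := fun u => Real.sq_sqrt (hmem u).1
    have hfp : Function.IsFixedPt
        (fun w : V → ℝ => fun v => sqrtBP lam (G.neighborFinset v) w) (fun v => √(ω v)) := by
      funext v
      change sqrtBP lam (G.neighborFinset v) _ = _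
      rw [← Real.sqrt_sq (Real.exp_pos _).le (x := sqrtBP lam _ _), sqrtBP_sq hlam.le]
      simp_rw [hsq]
      exact congrArg Real.sqrt (congrFun hfix v)
    have hw' := hc.fixedPoint_unique hfp
    funext v
    rw [← hsq v]
    exact congrArg (· ^ 2) (congrFun hw' v)

lemma tendsto_mul_lambdaC :
    Filter.Tendsto (fun D : ℕ => (D : ℝ) * lambdaC D) Filter.atTop (nhds (Real.exp 1)) := by
  rw [← Filter.tendsto_add_atTop_iff_nat 2]
  have hinv := tendsto_one_div_atTop_nhds_zero_nat (𝕜 := ℝ)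
  have hlim := (Real.tendsto_one_add_div_pow_exp 1).mul
    ((hinv.const_add 1).mul ((hinv.const_mul 2).const_add 1))
  norm_num only [add_zero, mul_zero, mul_one] at hlim
  refine hlim.congr' ?_
  filter_upwards [Filter.eventually_gt_atTop 0] with n hn
  have hn' : (n : ℝ) ≠ 0 := by positivity
  have hone : 1 + 1 / (n : ℝ) = (n + 1) / n := by field_simp
  have hcast : ((n : ℝ) + 2 - 1) = n + 1 := by ring
  simp only [lambdaC, Nat.cast_add, Nat.cast_ofNat, add_sub_cancel_right, hcast,
    show n + 2 - 1 = n + 1 by omega, hone, div_pow]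
  field_simp
  ring

end HardCore

theorem bpF_unique_fixed_point :
    ∀ δ : ℝ, 0 < δ →
    ∃ Δ₀ : ℕ,
      ∀ (V : Type) [Fintype V] [DecidableEq V] (G : SimpleGraph V) [DecidableRel G.Adj]
        (Δ : ℕ) (lam : ℝ),
        G.maxDegree = Δ → Δ₀ ≤ Δ →
        0 < lam → lam < (1 - δ) * lambdaC Δ →
        ∃! ω : V → ℝ, (∀ v : V, ω v ∈ Set.Icc (0 : ℝ) 1) ∧ bpF G lam ω = ω := by
  intro δ hδ
  have hlim := tendsto_mul_lambdaC.const_mul (1 - δ)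
  have hlt : (1 - δ) * Real.exp 1 < Real.exp 1 := by nlinarith [Real.exp_pos 1]
  obtain ⟨N, hN⟩ := Filter.eventually_atTop.1 (hlim.eventually_lt_const hlt)
  refine ⟨N, fun V _ _ G _ Δ lam hΔ hle hlam hlt => existsUnique_bpF_eq G hlam ?_⟩
  rw [hΔ]
  refine lt_of_le_of_lt ?_ (hN Δ hle)
  calc lam * Δ ≤ (1 - δ) * lambdaC Δ * Δ := by gcongr
    _ = (1 - δ) * (Δ * lambdaC Δ) := by ring
end
end

section
/- For all δ>0 there exists Δ₀=Δ₀(δ) such that for every finite graph G=(V,E) with maximum degree Δ≥Δ₀, every 0<λ<(1−δ)·λ_c(Δ), every ω∈[0,1]^V, every v∈V and every integer ℓ≥1: D_{v,ℓ−1}(F(ω), ω*) ≤ (1−δ/6)·D_{v,ℓ}(ω, ω*), where ω* is the unique fixed point of F. -/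
open scoped BigOperators

noncomputable section

namespace HardCore

/-- The potential function `Ψ(x) = λ^{-1/2}·arcsinh(√(λ·x))`. -/
def Psi (lam x : ℝ) : ℝ := (Real.sqrt lam)⁻¹ * Real.arsinh (Real.sqrt (lam * x))

variable {V : Type} [Fintype V] [DecidableEq V]

/-- The metric `D_{v,ℓ}(ω₁,ω₂) = max_{z ∈ B(v,ℓ)} |Ψ(ω₁(z)) - Ψ(ω₂(z))|`,
where `B(v,ℓ)` is the ball of radius `ℓ` around `v` in graph distance. -/
def Dmet (G : SimpleGraph V) (lam : ℝ) (v : V) (ℓ : ℕ) (ω₁ ω₂ : V → ℝ) : ℝ :=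
  sSup ((fun z => |Psi lam (ω₁ z) - Psi lam (ω₂ z)|) '' {z : V | G.edist v z ≤ (ℓ : ℕ∞)})

end HardCore

open HardCore

lemma Real.sq_sinh_div_cosh_le (t : ℝ) :
    (Real.sinh t / Real.cosh t) ^ 2 ≤ 2 * Real.log (Real.cosh t) := by
  have hc := Real.cosh_pos t
  have h := Real.one_sub_inv_le_log_of_pos (pow_pos hc 2)
  rw [Real.log_pow] at h
  have hs : (Real.sinh t / Real.cosh t) ^ 2 = 1 - (Real.cosh t ^ 2)⁻¹ := by
    rw [div_pow, Real.sinh_sq]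
    field_simp
  rw [hs]
  exact_mod_cast h

lemma Real.mul_exp_neg_le (x : ℝ) : x * Real.exp (-x) ≤ Real.exp (-1) := by
  have h := Real.add_one_le_exp (x - 1)
  have h2 := mul_le_mul_of_nonneg_right h (Real.exp_pos (-x)).le
  rw [← Real.exp_add] at h2
  ring_nf at h2 ⊢
  exact h2

/-- In the coordinates `t = arsinh √(lam * ω)`, one belief-propagation step is Lipschitz for the
sup norm, with constant `√(D * lam / e)`. -/
lemma abs_arsinh_prod_inv_cosh_sub_le {ι : Type*} (s : Finset ι) {D : ℝ} (hD : (s.card : ℝ) ≤ D)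
    {lam : ℝ} (hlam : 0 ≤ lam) {κ M : ℝ} (hκ : 0 ≤ κ) (hκD : D * lam * Real.exp (-1) ≤ κ ^ 2)
    (hM : 0 ≤ M) (a b : ι → ℝ) (hab : ∀ u ∈ s, |a u - b u| ≤ M) :
    |Real.arsinh (√lam * ∏ u ∈ s, (Real.cosh (a u))⁻¹) -
      Real.arsinh (√lam * ∏ u ∈ s, (Real.cosh (b u))⁻¹)| ≤ κ * M := by
  set t : ι → ℝ → ℝ := fun u x => b u + x * (a u - b u) with ht
  set L : ℝ → ℝ := fun x => ∑ u ∈ s, Real.log (Real.cosh (t u x)) with hL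
  set S : ℝ → ℝ := fun x => ∑ u ∈ s, Real.sinh (t u x) / Real.cosh (t u x) * (a u - b u) with hS
  have hexp (x : ℝ) : Real.exp (-L x) = ∏ u ∈ s, (Real.cosh (t u x))⁻¹ := by
    rw [hL, ← Finset.sum_neg_distrib, Real.exp_sum]
    refine Finset.prod_congr rfl fun u _ => ?_
    rw [Real.exp_neg, Real.exp_log (Real.cosh_pos _)]
  have hLd (x : ℝ) : HasDerivAt L (S x) x := by
    refine HasDerivAt.fun_sum fun u _ => ?_
    have h1 : HasDerivAt (t u) (a u - b u) x := by
      exact (hasDerivAt_mul_const (a u - b u)).const_add (b u)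
    rw [div_mul_eq_mul_div]
    exact h1.cosh.log (Real.cosh_pos _).ne'
  have hd (x : ℝ) : HasDerivAt (fun x => Real.arsinh (√lam * Real.exp (-L x)))
      ((√(1 + (√lam * Real.exp (-L x)) ^ 2))⁻¹ * (√lam * (Real.exp (-L x) * -S x))) x := by
    simpa [smul_eq_mul] using (((hLd x).fun_neg.exp).const_mul (√lam)).arsinh
  have hSsq (x : ℝ) : S x ^ 2 ≤ D * (M ^ 2 * (2 * L x)) := by
    have hterm : ∑ u ∈ s, (Real.sinh (t u x) / Real.cosh (t u x) * (a u - b u)) ^ 2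
        ≤ M ^ 2 * (2 * L x) := by
      rw [hL, Finset.mul_sum, Finset.mul_sum]
      refine Finset.sum_le_sum fun u hu => ?_
      rw [mul_pow, mul_comm]
      exact mul_le_mul (sq_le_sq' (neg_le_of_abs_le (hab u hu)) (le_of_abs_le (hab u hu)))
        (Real.sq_sinh_div_cosh_le _) (sq_nonneg _) (sq_nonneg _)
    calc S x ^ 2 ≤ s.card * ∑ u ∈ s,
          (Real.sinh (t u x) / Real.cosh (t u x) * (a u - b u)) ^ 2 := sq_sum_le_card_mul_sum_sq
      _ ≤ D * (M ^ 2 * (2 * L x)) :=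
          mul_le_mul hD hterm (Finset.sum_nonneg fun _ _ => sq_nonneg _)
            ((Nat.cast_nonneg _).trans hD)
  have hbound (x : ℝ) : ‖(√(1 + (√lam * Real.exp (-L x)) ^ 2))⁻¹ *
      (√lam * (Real.exp (-L x) * -S x))‖ ≤ κ * M := by
    have h1 : (√(1 + (√lam * Real.exp (-L x)) ^ 2))⁻¹ ≤ 1 :=
      inv_le_one_of_one_le₀ (Real.one_le_sqrt.2 (by linarith [sq_nonneg (√lam * Real.exp (-L x))]))
    have h2 : |√lam * (Real.exp (-L x) * -S x)| ≤ κ * M := by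
      refine abs_le_of_sq_le_sq ?_ (by positivity)
      have he : Real.exp (-L x) ^ 2 = Real.exp (-(2 * L x)) := by
        rw [← Real.exp_nat_mul]
        push_cast
        ring_nf
      calc (√lam * (Real.exp (-L x) * -S x)) ^ 2
          = lam * Real.exp (-(2 * L x)) * S x ^ 2 := by
            rw [mul_pow, mul_pow, Real.sq_sqrt hlam, he]
            ring
        _ ≤ lam * Real.exp (-(2 * L x)) * (D * (M ^ 2 * (2 * L x))) := by
            gcongr
            exact hSsq x
        _ = D * lam * M ^ 2 * (2 * L x * Real.exp (-(2 * L x))) := by ring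
        _ ≤ D * lam * M ^ 2 * Real.exp (-1) := by
            have : 0 ≤ D := (Nat.cast_nonneg _).trans hD
            gcongr
            exact Real.mul_exp_neg_le _
        _ = D * lam * Real.exp (-1) * M ^ 2 := by ring
        _ ≤ κ ^ 2 * M ^ 2 := by gcongr
        _ = (κ * M) ^ 2 := by ring
    rw [norm_mul, Real.norm_eq_abs, Real.norm_eq_abs, abs_of_nonneg (by positivity)]
    exact (mul_le_of_le_one_left (abs_nonneg _) h1).trans h2
  have hmvt := convex_univ.norm_image_sub_le_of_norm_hasDerivWithin_le
    (fun x _ => (hd x).hasDerivWithinAt) (fun x _ => hbound x)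
    (Set.mem_univ (0 : ℝ)) (Set.mem_univ (1 : ℝ))
  simpa [hexp, ht] using hmvt

namespace HardCore

lemma mul_lambdaC_mul_exp_neg_one_le {n : ℕ} (hn : 0 < n) :
    ((n + 2 : ℕ) : ℝ) * lambdaC (n + 2) * Real.exp (-1) ≤ 1 + 5 / n := by
  have hn' : (0 : ℝ) < n := Nat.cast_pos.2 hn
  have hn1 : (1 : ℝ) ≤ n := Nat.one_le_cast.2 hn
  have hpow : (1 + 1 / (n : ℝ)) ^ n ≤ Real.exp 1 := by
    calc (1 + 1 / (n : ℝ)) ^ n ≤ Real.exp (1 / n) ^ n := by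
          gcongr
          linarith [Real.add_one_le_exp (1 / (n : ℝ))]
      _ = Real.exp 1 := by
          rw [← Real.exp_nat_mul]
          congr 1
          field_simp
  have heq : ((n + 2 : ℕ) : ℝ) * lambdaC (n + 2)
      = (1 + 1 / (n : ℝ)) ^ n * ((1 + 1 / n) * (1 + 2 / n)) := by
    have h1 : ((n + 2 : ℕ) : ℝ) - 1 = n + 1 := by push_cast; ring
    have h2 : ((n + 2 : ℕ) : ℝ) - 2 = n := by push_cast; ring
    have h3 : 1 + 1 / (n : ℝ) = (n + 1) / n := by field_simp
    rw [lambdaC, h1, h2, h3, div_pow, show n + 2 - 1 = n + 1 from rfl, pow_succ, pow_add]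
    push_cast
    field_simp
  have hrat : (1 + 1 / (n : ℝ)) * (1 + 2 / n) ≤ 1 + 5 / n := by
    have h : 1 + 5 / (n : ℝ) - (1 + 1 / n) * (1 + 2 / n) = 2 * (n - 1) / n ^ 2 := by
      field_simp
      ring
    have : 0 ≤ 2 * ((n : ℝ) - 1) / n ^ 2 := div_nonneg (by linarith) (by positivity)
    linarith
  calc ((n + 2 : ℕ) : ℝ) * lambdaC (n + 2) * Real.exp (-1)
      ≤ Real.exp 1 * (1 + 5 / n) * Real.exp (-1) := by
        rw [heq]
        gcongr
    _ = 1 + 5 / n := by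
        rw [mul_right_comm, ← Real.exp_add]
        simp

lemma lambdaC_pos {n : ℕ} (hn : 0 < n) : 0 < lambdaC (n + 2) := by
  have hn' : (0 : ℝ) < n := Nat.cast_pos.2 hn
  have h1 : ((n + 2 : ℕ) : ℝ) - 1 = n + 1 := by push_cast; ring
  have h2 : ((n + 2 : ℕ) : ℝ) - 2 = n := by push_cast; ring
  rw [lambdaC, h1, h2]
  positivity

variable {V : Type} [Fintype V]

lemma abs_Psi_sub (lam x y : ℝ) : |Psi lam x - Psi lam y| =
    (√lam)⁻¹ * |Real.arsinh √(lam * x) - Real.arsinh √(lam * y)| := by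
  rw [Psi, Psi, ← mul_sub, abs_mul, abs_of_nonneg (by positivity)]

lemma sqrt_mul_bpF (G : SimpleGraph V) [DecidableRel G.Adj] {lam : ℝ} (hlam : 0 ≤ lam)
    {ω : V → ℝ} (hω : ∀ u, 0 ≤ ω u) (z : V) :
    √(lam * bpF G lam ω z) =
      √lam * ∏ u ∈ G.neighborFinset z, (Real.cosh (Real.arsinh √(lam * ω u)))⁻¹ := by
  have h : bpF G lam ω z =
      (∏ u ∈ G.neighborFinset z, (Real.cosh (Real.arsinh √(lam * ω u)))⁻¹) ^ 2 := by
    rw [bpF, ← Finset.prod_pow]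
    refine Finset.prod_congr rfl fun u _ => ?_
    have := hω u
    rw [inv_pow, Real.cosh_sq, Real.sinh_arsinh, Real.sq_sqrt (by positivity), add_comm]
  rw [h, Real.sqrt_mul hlam, Real.sqrt_sq]
  exact Finset.prod_nonneg fun u _ => (inv_pos.2 (Real.cosh_pos _)).le

lemma abs_Psi_sub_le_Dmet (G : SimpleGraph V) (lam : ℝ) {v z : V} {ℓ : ℕ} (ω₁ ω₂ : V → ℝ)
    (hz : G.edist v z ≤ ℓ) : |Psi lam (ω₁ z) - Psi lam (ω₂ z)| ≤ Dmet G lam v ℓ ω₁ ω₂ :=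
  le_csSup (Set.toFinite _).bddAbove (Set.mem_image_of_mem _ hz)

lemma Dmet_bpF_le (G : SimpleGraph V) [DecidableRel G.Adj] {lam κ : ℝ} (hlam : 0 < lam)
    (hκ : 0 ≤ κ) (hκG : G.maxDegree * lam * Real.exp (-1) ≤ κ ^ 2)
    {ω₁ ω₂ : V → ℝ} (hω₁ : ∀ u, 0 ≤ ω₁ u) (hω₂ : ∀ u, 0 ≤ ω₂ u) (v : V) (k : ℕ) :
    Dmet G lam v k (bpF G lam ω₁) (bpF G lam ω₂) ≤ κ * Dmet G lam v (k + 1) ω₁ ω₂ := by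
  have hsq : 0 < √lam := Real.sqrt_pos.2 hlam
  have hnonneg : 0 ≤ Dmet G lam v (k + 1) ω₁ ω₂ :=
    (abs_nonneg _).trans (abs_Psi_sub_le_Dmet G lam (z := v) ω₁ ω₂ (by simp))
  refine csSup_le (Set.Nonempty.image _ ⟨v, by simp⟩) ?_
  rintro _ ⟨z, hz, rfl⟩
  have hlip := abs_arsinh_prod_inv_cosh_sub_le (G.neighborFinset z) (D := G.maxDegree)
    (by
      rw [SimpleGraph.card_neighborFinset_eq_degree]
      exact_mod_cast G.degree_le_maxDegree z)
    hlam.le hκ hκG (M := √lam * Dmet G lam v (k + 1) ω₁ ω₂) (by positivity)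
    (fun u => Real.arsinh √(lam * ω₁ u)) (fun u => Real.arsinh √(lam * ω₂ u))
    (fun u hu => by
      have hadj : G.Adj z u := (G.mem_neighborFinset z u).1 hu
      have hu' : G.edist v u ≤ ((k + 1 : ℕ) : ℕ∞) := by
        push_cast
        exact G.edist_triangle.trans
          (add_le_add hz (SimpleGraph.edist_eq_one_iff_adj.2 hadj).le)
      have h := abs_Psi_sub_le_Dmet G lam ω₁ ω₂ hu'
      rwa [abs_Psi_sub, inv_mul_le_iff₀ hsq] at h)
  simp only
  rw [abs_Psi_sub, sqrt_mul_bpF G hlam.le hω₁, sqrt_mul_bpF G hlam.le hω₂, inv_mul_le_iff₀ hsq]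
  linarith

end HardCore

theorem bp_stepwise_contraction :
    ∀ δ : ℝ, 0 < δ →
    ∃ Δ₀ : ℕ,
      ∀ (V : Type) [Fintype V] [DecidableEq V] (G : SimpleGraph V) [DecidableRel G.Adj]
        (Δ : ℕ) (lam : ℝ),
        G.maxDegree = Δ → Δ₀ ≤ Δ →
        0 < lam → lam < (1 - δ) * lambdaC Δ →
        ∀ ωstar : V → ℝ, (∀ u : V, ωstar u ∈ Set.Icc (0 : ℝ) 1) →
          bpF G lam ωstar = ωstar →
        ∀ ω : V → ℝ, (∀ u : V, ω u ∈ Set.Icc (0 : ℝ) 1) →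
        ∀ (v : V) (ℓ : ℕ), 1 ≤ ℓ →
          Dmet G lam v (ℓ - 1) (bpF G lam ω) ωstar ≤ (1 - δ / 6) * Dmet G lam v ℓ ω ωstar := by
  intro δ hδ
  obtain ⟨N, hN⟩ := exists_nat_ge (8 / δ)
  refine ⟨N + 3, ?_⟩
  intro V _ _ G _ Δ lam hmax hΔ hlam hlt ωstar hωstar hfix ω hω v ℓ hℓ
  obtain ⟨n, rfl⟩ : ∃ n, Δ = n + 2 := ⟨Δ - 2, by omega⟩
  obtain ⟨k, rfl⟩ : ∃ k, ℓ = k + 1 := ⟨ℓ - 1, by omega⟩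
  have hn : 0 < n := by omega
  have hn' : (0 : ℝ) < n := Nat.cast_pos.2 hn
  have hδ1 : δ < 1 := by
    linarith [pos_of_mul_pos_left (hlam.trans hlt) (lambdaC_pos hn).le]
  have h5 : 5 / (n : ℝ) ≤ 5 * δ / 8 := by
    have hNn : (N : ℝ) ≤ n := by exact_mod_cast (by omega : N ≤ n)
    have h8 := (div_le_iff₀ hδ).1 (hN.trans hNn)
    rw [div_le_iff₀ hn']
    linarith
  have hκ : G.maxDegree * lam * Real.exp (-1) ≤ (1 - δ / 6) ^ 2 := by
    rw [hmax]
    calc ((n + 2 : ℕ) : ℝ) * lam * Real.exp (-1)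
        ≤ ((n + 2 : ℕ) : ℝ) * ((1 - δ) * lambdaC (n + 2)) * Real.exp (-1) := by gcongr
      _ = (1 - δ) * (((n + 2 : ℕ) : ℝ) * lambdaC (n + 2) * Real.exp (-1)) := by ring
      _ ≤ (1 - δ) * (1 + 5 / n) :=
          mul_le_mul_of_nonneg_left (mul_lambdaC_mul_exp_neg_one_le hn) (by linarith)
      _ ≤ (1 - δ) * (1 + 5 * δ / 8) := by
          refine mul_le_mul_of_nonneg_left ?_ (by linarith)
          linarith
      _ ≤ (1 - δ / 6) ^ 2 := by nlinarith [sq_nonneg δ]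
  have h := Dmet_bpF_le G hlam (by linarith) hκ (fun u => (hω u).1) (fun u => (hωstar u).1) v k
  rwa [hfix] at h
end
end

section
/- For all δ,ε>0 there exist Δ₀=Δ₀(δ,ε) and C=C(δ,ε) such that for every finite graph G=(V,E) with maximum degree Δ≥Δ₀ and girth at least 6, every 0<λ<(1−δ)·λ_c(Δ), and every v∈V: if X is a random independent set distributed according to the hard-core Gibbs distribution μ, then P( |S_X(v) − Σ_{z∈N(v)} ω*(z)| ≤ ε·Δ ) ≥ 1 − exp(−Δ/C), where ω* is the unique fixed point of the belief-propagation operator F. -/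
open scoped BigOperators

attribute [local instance] Classical.propDecidable

noncomputable section

namespace HardCore

variable {V : Type} [Fintype V] [DecidableEq V]

/-- `s` is an independent set of `G`. -/
def IsIndep (G : SimpleGraph V) (s : Finset V) : Prop :=
  ∀ u ∈ s, ∀ w ∈ s, ¬ G.Adj u w

/-- hard-core weight `λ^|σ|` of an independent set (0 for non-independent sets). -/
def weight (G : SimpleGraph V) (lam : ℝ) (s : Finset V) : ℝ :=
  if IsIndep G s then lam ^ s.card else 0

/-- The hard-core Gibbs distribution `μ(σ) = λ^|σ| / Z`. -/
def gibbs (G : SimpleGraph V) (lam : ℝ) (s : Finset V) : ℝ :=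
  weight G lam s / ∑ t : Finset V, weight G lam t

/-- Probability of an event under the Gibbs distribution. -/
def gibbsProb (G : SimpleGraph V) (lam : ℝ) (A : Set (Finset V)) : ℝ :=
  ∑ s : Finset V, if s ∈ A then gibbs G lam s else 0

/-- `U_{v,p}(σ)`: indicator that `σ ∩ (N(v) \ {p}) = ∅`. -/
def unblockedInd (G : SimpleGraph V) [DecidableRel G.Adj] (σ : Finset V) (v p : V) : ℝ :=
  if σ ∩ ((G.neighborFinset v).erase p) = ∅ then 1 else 0

/-- `S_σ(v) = ∑_{z ∈ N(v)} U_{z,v}(σ)`, the number of unblocked neighbors of `v`. -/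
def Ssum (G : SimpleGraph V) [DecidableRel G.Adj] (σ : Finset V) (v : V) : ℝ :=
  ∑ z ∈ G.neighborFinset v, unblockedInd G σ z v

end HardCore

namespace HardCore

set_option linter.unusedSectionVars false

section FiniteSums

variable {α : Type*} [DecidableEq α]

lemma sum_powerset_union_of_disjoint {s t : Finset α} (h : Disjoint s t) (f : Finset α → ℝ) :
    ∑ ρ ∈ (s ∪ t).powerset, f ρ = ∑ a ∈ s.powerset, ∑ b ∈ t.powerset, f (a ∪ b) := by
  rw [← Finset.sum_product']
  symm
  refine Finset.sum_nbij' (fun p => p.1 ∪ p.2) (fun ρ => (ρ ∩ s, ρ ∩ t)) ?_ ?_ ?_ ?_ ?_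
  · rintro ⟨a, b⟩ hab
    simp only [Finset.mem_product, Finset.mem_powerset] at hab ⊢
    exact Finset.union_subset_union hab.1 hab.2
  · intro ρ _
    simp
  · rintro ⟨a, b⟩ hab
    simp only [Finset.mem_product, Finset.mem_powerset] at hab
    obtain ⟨ha, hb⟩ := hab
    have h1 : b ∩ s = ∅ := Finset.disjoint_iff_inter_eq_empty.1 (h.symm.mono_left hb)
    have h2 : a ∩ t = ∅ := Finset.disjoint_iff_inter_eq_empty.1 (h.mono_left ha)
    simp [Finset.union_inter_distrib_right, h1, h2, Finset.inter_eq_left.2 ha,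
      Finset.inter_eq_left.2 hb]
  · intro ρ hρ
    simp only [Finset.mem_powerset] at hρ
    simp [← Finset.inter_union_distrib_left, Finset.inter_eq_left.2 hρ]
  · rintro ⟨a, b⟩ _
    rfl

lemma sum_powerset_biUnion_prod {ι : Type*} [DecidableEq ι] (N : Finset ι) (D : ι → Finset α)
    (hD : (N : Set ι).PairwiseDisjoint D) (g : ι → Finset α → ℝ) :
    ∑ ρ ∈ (N.biUnion D).powerset, ∏ z ∈ N, g z (ρ ∩ D z) =
      ∏ z ∈ N, ∑ ρ ∈ (D z).powerset, g z ρ := by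
  induction N using Finset.induction_on with
  | empty => simp
  | insert a N ha ih =>
    have hdisj : ∀ z ∈ N, Disjoint (D a) (D z) := fun z hz =>
      hD (by simp) (by simp [hz]) (by rintro rfl; exact ha hz)
    have hdisjU : Disjoint (D a) (N.biUnion D) := by
      rw [Finset.disjoint_biUnion_right]
      exact hdisj
    rw [Finset.biUnion_insert, sum_powerset_union_of_disjoint hdisjU, Finset.prod_insert ha,
      ← ih (hD.subset (by simp)), Finset.sum_mul_sum]
    refine Finset.sum_congr rfl fun x hx => Finset.sum_congr rfl fun y hy => ?_
    rw [Finset.mem_powerset] at hx hy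
    rw [Finset.prod_insert ha]
    refine congrArg₂ (· * ·) (congrArg (g a) ?_)
      (Finset.prod_congr rfl fun z hz => congrArg (g z) ?_)
    · have : y ∩ D a = ∅ :=
        Finset.disjoint_iff_inter_eq_empty.1 (hdisjU.symm.mono_left hy)
      rw [Finset.union_inter_distrib_right, this, Finset.inter_eq_left.2 hx, Finset.union_empty]
    · have : x ∩ D z = ∅ :=
        Finset.disjoint_iff_inter_eq_empty.1 ((hdisj z hz).mono_left hx)
      rw [Finset.union_inter_distrib_right, this, Finset.empty_union]

lemma sum_powerset_pow_card (A : Finset α) (x : ℝ) :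
    ∑ ρ ∈ A.powerset, x ^ ρ.card = (1 + x) ^ A.card := by
  have := Finset.sum_pow_mul_eq_add_pow x 1 A
  simpa [add_comm] using this

lemma sum_powerset_pow_card_mul_ite (A : Finset α) (x a b : ℝ) :
    ∑ ρ ∈ A.powerset, x ^ ρ.card * (if ρ = ∅ then a else b) =
      a + ((1 + x) ^ A.card - 1) * b := by
  have h : ∀ ρ ∈ A.powerset, x ^ ρ.card * (if ρ = ∅ then a else b) =
      x ^ ρ.card * b + if ρ = ∅ then a - b else 0 := by
    intro ρ _
    split_ifs with h0
    · simp [h0]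
    · simp
  rw [Finset.sum_congr rfl h, Finset.sum_add_distrib, ← Finset.sum_mul, sum_powerset_pow_card,
    Finset.sum_ite_eq' A.powerset ∅ fun _ => a - b]
  simp
  ring

end FiniteSums

section Conditioning

variable {V : Type} [Fintype V] [DecidableEq V]

/-- The vertices of `L` without a neighbor in `τ`. -/
def avail (G : SimpleGraph V) (L τ : Finset V) : Finset V :=
  L.filter fun y => ∀ u ∈ τ, ¬ G.Adj u y

lemma weight_union {G : SimpleGraph V} {L τ ρ : Finset V} (lam : ℝ) (hL : IsIndep G L)
    (hτ : Disjoint τ L) (hρ : ρ ⊆ L) :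
    weight G lam (τ ∪ ρ) =
      if ρ ⊆ avail G L τ then weight G lam τ * lam ^ ρ.card else 0 := by
  have hd : Disjoint τ ρ := hτ.mono_right hρ
  have key : IsIndep G (τ ∪ ρ) ↔ IsIndep G τ ∧ ρ ⊆ avail G L τ := by
    constructor
    · intro h
      refine ⟨fun u hu w hw => h u (by simp [hu]) w (by simp [hw]), fun y hy => ?_⟩
      simp only [avail, Finset.mem_filter]
      exact ⟨hρ hy, fun u hu => h u (by simp [hu]) y (by simp [hy])⟩
    · rintro ⟨h1, h2⟩ u hu w hw
      have h3 : ∀ y ∈ ρ, ∀ u ∈ τ, ¬ G.Adj u y := fun y hy => (Finset.mem_filter.1 (h2 hy)).2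
      rcases Finset.mem_union.1 hu with hu | hu <;> rcases Finset.mem_union.1 hw with hw | hw
      · exact h1 u hu w hw
      · exact h3 w hw u hu
      · exact fun h => h3 u hu w hw h.symm
      · exact hL u (hρ hu) w (hρ hw)
  unfold weight
  simp only [key, Finset.card_union_of_disjoint hd, pow_add]
  by_cases h1 : IsIndep G τ <;> by_cases h2 : ρ ⊆ avail G L τ <;> simp [h1, h2]

lemma weight_nonneg (G : SimpleGraph V) {lam : ℝ} (hlam : 0 < lam) (s : Finset V) :
    0 ≤ weight G lam s := by
  unfold weight
  split_ifs
  · positivity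
  · exact le_rfl

lemma sum_weight_mul_eq {G : SimpleGraph V} {L : Finset V} (lam : ℝ) (hL : IsIndep G L)
    (f : Finset V → ℝ) :
    ∑ σ : Finset V, weight G lam σ * f σ =
      ∑ τ ∈ (Lᶜ).powerset, weight G lam τ *
        ∑ ρ ∈ (avail G L τ).powerset, lam ^ ρ.card * f (τ ∪ ρ) := by
  have hu : (Finset.univ : Finset (Finset V)) = (Lᶜ ∪ L).powerset := by
    rw [Finset.union_comm, Finset.union_compl, Finset.powerset_univ]
  rw [hu, sum_powerset_union_of_disjoint disjoint_compl_left]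
  refine Finset.sum_congr rfl fun τ hτ => ?_
  have hd : Disjoint τ L :=
    disjoint_compl_left.mono_left (Finset.mem_powerset.1 hτ)
  have hsub : (avail G L τ).powerset ⊆ L.powerset :=
    Finset.powerset_mono.2 (Finset.filter_subset _ _)
  rw [Finset.mul_sum, ← Finset.sum_subset hsub]
  · refine Finset.sum_congr rfl fun ρ hρ => ?_
    rw [weight_union lam hL hd (Finset.mem_powerset.1 (hsub hρ)),
      if_pos (Finset.mem_powerset.1 hρ), mul_assoc]
  · intro ρ hρ hρ'
    rw [weight_union lam hL hd (Finset.mem_powerset.1 hρ),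
      if_neg (fun h => hρ' (Finset.mem_powerset.2 h)), zero_mul]

lemma sum_weight_mul_le {G : SimpleGraph V} {L : Finset V} {lam : ℝ} (hlam : 0 < lam)
    (hL : IsIndep G L) (f : Finset V → ℝ) (M : ℝ)
    (h : ∀ τ, Disjoint τ L → ∑ ρ ∈ (avail G L τ).powerset, lam ^ ρ.card * f (τ ∪ ρ) ≤
      M * (1 + lam) ^ (avail G L τ).card) :
    ∑ σ : Finset V, weight G lam σ * f σ ≤ M * ∑ σ : Finset V, weight G lam σ := by
  have h1 := sum_weight_mul_eq lam hL (fun _ => (1 : ℝ))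
  simp only [mul_one, sum_powerset_pow_card] at h1
  rw [h1, sum_weight_mul_eq lam hL f, Finset.mul_sum]
  refine Finset.sum_le_sum fun τ hτ => ?_
  rw [mul_left_comm]
  exact mul_le_mul_of_nonneg_left
    (h τ (disjoint_compl_left.mono_left (Finset.mem_powerset.1 hτ))) (weight_nonneg G hlam τ)

lemma bernoulli_mgf_le {q r : ℝ} (hq0 : 0 ≤ q) (hq1 : q ≤ 1) (hr : |r| ≤ 1) :
    q * Real.exp (r * (1 - q)) + (1 - q) * Real.exp (r * (0 - q)) ≤ Real.exp (r ^ 2) := by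
  have hx : ∀ x : ℝ, |x| ≤ 1 → Real.exp x ≤ 1 + x + x ^ 2 := fun x hx => by
    have := (abs_le.1 (Real.abs_exp_sub_one_sub_id_le hx)).2
    linarith
  have h1 : |r * (1 - q)| ≤ 1 := by
    rw [abs_mul, abs_of_nonneg (by linarith : 0 ≤ 1 - q)]
    nlinarith [abs_nonneg r]
  have h2 : |r * (0 - q)| ≤ 1 := by
    rw [abs_mul, zero_sub, abs_neg, abs_of_nonneg hq0]
    nlinarith [abs_nonneg r]
  have h3 := mul_le_mul_of_nonneg_left (hx _ h1) hq0
  have h4 := mul_le_mul_of_nonneg_left (hx _ h2) (by linarith : 0 ≤ 1 - q)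
  have h5 := Real.add_one_le_exp (r ^ 2)
  have h6 : 0 ≤ r ^ 2 * (1 - q * (1 - q)) := by
    apply mul_nonneg (sq_nonneg r)
    nlinarith
  nlinarith

/-- The conditional probability, given the configuration outside `D`, that `D` is empty. -/
def emptyProb (G : SimpleGraph V) (lam : ℝ) (D σ : Finset V) : ℝ :=
  ((1 + lam) ^ (avail G D σ).card)⁻¹

lemma sum_weight_mul_exp_empty_sub_le {G : SimpleGraph V} {lam : ℝ} (hlam : 0 < lam)
    (N : Finset V) (D : V → Finset V) (hD : (N : Set V).PairwiseDisjoint D)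
    (hL : IsIndep G (N.biUnion D)) {r : ℝ} (hr : |r| ≤ 1) :
    ∑ σ : Finset V, weight G lam σ *
        Real.exp (r * ∑ z ∈ N, ((if σ ∩ D z = ∅ then 1 else 0) - emptyProb G lam (D z) σ)) ≤
      Real.exp (r ^ 2) ^ N.card * ∑ σ : Finset V, weight G lam σ := by
  refine sum_weight_mul_le hlam hL _ _ fun τ hτ => ?_
  set A : V → Finset V := fun z => avail G (D z) τ with hA
  have hAD : ∀ z, A z ⊆ D z := fun z => Finset.filter_subset _ _
  have hAdisj : (N : Set V).PairwiseDisjoint A := hD.mono hAD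
  have hU : avail G (N.biUnion D) τ = N.biUnion A := by
    simp only [avail, hA, Finset.filter_biUnion]
  set q : V → ℝ := fun z => emptyProb G lam (D z) τ with hq
  have hterm : ∀ ρ ∈ (N.biUnion A).powerset, lam ^ ρ.card * Real.exp (r * ∑ z ∈ N,
      ((if (τ ∪ ρ) ∩ D z = ∅ then 1 else 0) - emptyProb G lam (D z) (τ ∪ ρ))) =
      ∏ z ∈ N, lam ^ (ρ ∩ A z).card *
        (if ρ ∩ A z = ∅ then Real.exp (r * (1 - q z)) else Real.exp (r * (0 - q z))) := by
    intro ρ hρ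
    rw [Finset.mem_powerset] at hρ
    have hcard : ρ.card = ∑ z ∈ N, (ρ ∩ A z).card := by
      rw [← Finset.card_biUnion (hAdisj.mono fun z => Finset.inter_subset_right),
        ← Finset.inter_biUnion, Finset.inter_eq_left.2 hρ]
    have hρL : ρ ⊆ N.biUnion D := hρ.trans (hU ▸ Finset.filter_subset _ _)
    rw [hcard, ← Finset.prod_pow_eq_pow_sum, Finset.mul_sum, Real.exp_sum,
      ← Finset.prod_mul_distrib]
    refine Finset.prod_congr rfl fun z hz => ?_
    have hDz : D z ⊆ N.biUnion D := Finset.subset_biUnion_of_mem D hz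
    have hav : emptyProb G lam (D z) (τ ∪ ρ) = q z := by
      have : avail G (D z) (τ ∪ ρ) = avail G (D z) τ := by
        unfold avail
        refine Finset.filter_congr fun y hy => ⟨fun h u hu => h u (by simp [hu]), ?_⟩
        intro h u hu
        rcases Finset.mem_union.1 hu with hu | hu
        · exact h u hu
        · exact hL u (hρL hu) y (hDz hy)
      simp only [hq, emptyProb, this]
    have hinter : (τ ∪ ρ) ∩ D z = ρ ∩ A z := by
      have h1 : τ ∩ D z = ∅ := Finset.disjoint_iff_inter_eq_empty.1 (hτ.mono_right hDz)
      rw [Finset.union_inter_distrib_right, h1, Finset.empty_union]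
      refine Finset.Subset.antisymm (fun y hy => ?_)
        (Finset.inter_subset_inter_left (hAD z))
      rw [Finset.mem_inter] at hy ⊢
      refine ⟨hy.1, Finset.mem_filter.2 ⟨hy.2, ?_⟩⟩
      have := hρ hy.1
      rw [← hU] at this
      exact (Finset.mem_filter.1 this).2
    rw [hav, hinter]
    congr 1
    split_ifs <;> rfl
  rw [hU, Finset.sum_congr rfl hterm, sum_powerset_biUnion_prod N A hAdisj (fun z ρ =>
    lam ^ ρ.card * if ρ = ∅ then Real.exp (r * (1 - q z)) else Real.exp (r * (0 - q z))),
    Finset.card_biUnion hAdisj, ← Finset.prod_pow_eq_pow_sum, ← Finset.prod_const,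
    ← Finset.prod_mul_distrib]
  refine Finset.prod_le_prod (fun z _ => Finset.sum_nonneg fun ρ _ => ?_) fun z _ => ?_
  · split_ifs <;> positivity
  · rw [sum_powerset_pow_card_mul_ite]
    have hK1 : 1 ≤ (1 + lam) ^ (A z).card := one_le_pow₀ (by linarith)
    have hqK : q z = ((1 + lam) ^ (A z).card)⁻¹ := rfl
    set K := (1 + lam) ^ (A z).card
    have hK : 0 < K := by linarith
    have hq1 : q z ≤ 1 := hqK ▸ inv_le_one_of_one_le₀ hK1
    have := mul_le_mul_of_nonneg_right
      (bernoulli_mgf_le (hqK ▸ (inv_pos.2 hK).le : 0 ≤ q z) hq1 hr) hK.le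
    refine le_trans (le_of_eq ?_) this
    have hKq : q z * K = 1 := by rw [hqK]; exact inv_mul_cancel₀ hK.ne'
    linear_combination (Real.exp (r * (0 - q z)) - Real.exp (r * (1 - q z))) * hKq

lemma sum_weight_mul_exp_card_inter_le {G : SimpleGraph V} {lam : ℝ} (hlam : 0 < lam)
    {L : Finset V} (hL : IsIndep G L) :
    ∑ σ : Finset V, weight G lam σ * Real.exp ((σ ∩ L).card : ℝ) ≤
      Real.exp (3 * lam * L.card) * ∑ σ : Finset V, weight G lam σ := by
  refine sum_weight_mul_le hlam hL _ _ fun τ hτ => ?_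
  have hAL : avail G L τ ⊆ L := Finset.filter_subset _ _
  have hterm : ∀ ρ ∈ (avail G L τ).powerset,
      lam ^ ρ.card * Real.exp (((τ ∪ ρ) ∩ L).card : ℝ) = (lam * Real.exp 1) ^ ρ.card := by
    intro ρ hρ
    have h1 : τ ∩ L = ∅ := Finset.disjoint_iff_inter_eq_empty.1 hτ
    rw [Finset.union_inter_distrib_right, h1, Finset.empty_union,
      Finset.inter_eq_left.2 ((Finset.mem_powerset.1 hρ).trans hAL), mul_pow, ← Real.exp_nat_mul,
      mul_one]
  rw [Finset.sum_congr rfl hterm, sum_powerset_pow_card]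
  have h1 : (1 : ℝ) ≤ (1 + lam) ^ (avail G L τ).card := one_le_pow₀ (by linarith)
  have h2 : (1 + lam * Real.exp 1) ^ (avail G L τ).card ≤ Real.exp (3 * lam * L.card) := by
    calc (1 + lam * Real.exp 1) ^ (avail G L τ).card
        ≤ Real.exp (3 * lam) ^ (avail G L τ).card := by
          apply pow_le_pow_left₀ (by positivity)
          have := Real.add_one_le_exp (3 * lam)
          nlinarith [Real.exp_one_lt_d9]
      _ = Real.exp (3 * lam * (avail G L τ).card) := by
          rw [← Real.exp_nat_mul]; ring_nf
      _ ≤ _ := by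
          apply Real.exp_le_exp.2
          gcongr
  exact h2.trans (le_mul_of_one_le_right (Real.exp_pos _).le h1)

end Conditioning

section Girth

variable {V : Type} {G : SimpleGraph V}

lemma not_adj_of_six_le_egirth (hg : 6 ≤ G.egirth) {a b c : V} (h1 : G.Adj a b)
    (h2 : G.Adj b c) : ¬ G.Adj c a := by
  intro h3
  have hc : (SimpleGraph.Walk.cons h1 (.cons h2 (.cons h3 .nil))).IsCycle := by
    simp [SimpleGraph.Walk.cons_isCycle_iff, h1.ne, h1.ne', h2.ne, h3.ne, h3.ne']
  have := SimpleGraph.le_egirth.1 hg _ _ hc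
  norm_num at this

lemma eq_of_four_cycle (hg : 6 ≤ G.egirth) {a b c d : V} (h1 : G.Adj a b)
    (h2 : G.Adj b c) (h3 : G.Adj c d) (h4 : G.Adj d a) (hac : a ≠ c) : b = d := by
  by_contra hbd
  have hc : (SimpleGraph.Walk.cons h1 (.cons h2 (.cons h3 (.cons h4 .nil)))).IsCycle := by
    simp [SimpleGraph.Walk.cons_isCycle_iff, h1.ne, h1.ne', h2.ne, h3.ne,
      h4.ne, h4.ne', hac, hac.symm, hbd]
  have := SimpleGraph.le_egirth.1 hg _ _ hc
  norm_num at this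

lemma eq_of_five_cycle (hg : 6 ≤ G.egirth) {a b c d e : V} (h1 : G.Adj a b)
    (h2 : G.Adj b c) (h3 : G.Adj c d) (h4 : G.Adj d e) (h5 : G.Adj e a)
    (hac : a ≠ c) (had : a ≠ d) : b = e := by
  by_contra hbe
  have hbd : b ≠ d := fun h => not_adj_of_six_le_egirth hg h4 h5 (h ▸ h1)
  have hce : c ≠ e := fun h => not_adj_of_six_le_egirth hg h1 (h ▸ h2) h5
  have hc : (SimpleGraph.Walk.cons h1
      (.cons h2 (.cons h3 (.cons h4 (.cons h5 .nil))))).IsCycle := by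
    simp [SimpleGraph.Walk.cons_isCycle_iff, h1.ne, h1.ne', h2.ne, h3.ne,
      h4.ne, h5.ne, h5.ne', hac, hac.symm, had, had.symm, hbe, hbd, hce]
  have := SimpleGraph.le_egirth.1 hg _ _ hc
  norm_num at this

variable [Fintype V] [DecidableEq V] [DecidableRel G.Adj]

lemma isIndep_neighborFinset (hg : 6 ≤ G.egirth) (v : V) : IsIndep G (G.neighborFinset v) := by
  intro u hu w hw h
  rw [SimpleGraph.mem_neighborFinset] at hu hw
  exact not_adj_of_six_le_egirth hg hu h hw.symm

lemma pairwiseDisjoint_neighborFinset_erase (hg : 6 ≤ G.egirth) (v : V) :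
    (G.neighborFinset v : Set V).PairwiseDisjoint fun z => (G.neighborFinset z).erase v := by
  intro z hz z' hz' hne
  rw [Function.onFun, Finset.disjoint_left]
  intro y hy hy'
  simp only [Finset.mem_coe, SimpleGraph.mem_neighborFinset, Finset.mem_erase] at hz hz' hy hy'
  exact hne (eq_of_four_cycle hg hz hy.2 hy'.2.symm hz'.symm hy.1.symm)

lemma isIndep_biUnion_neighborFinset_erase (hg : 6 ≤ G.egirth) (v : V) :
    IsIndep G ((G.neighborFinset v).biUnion fun z => (G.neighborFinset z).erase v) := by
  intro y hy y' hy' h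
  simp only [Finset.mem_biUnion, SimpleGraph.mem_neighborFinset, Finset.mem_erase] at hy hy'
  obtain ⟨z, hz, hyv, hzy⟩ := hy
  obtain ⟨z', hz', hyv', hzy'⟩ := hy'
  have := eq_of_five_cycle hg hz hzy h hzy'.symm hz'.symm hyv.symm hyv'.symm
  subst this
  exact not_adj_of_six_le_egirth hg hzy h hzy'.symm

end Girth

section Probability

lemma abs_exp_neg_sub_exp_neg_le {a b : ℝ} (ha : 0 ≤ a) (hb : 0 ≤ b) :
    |Real.exp (-a) - Real.exp (-b)| ≤ |a - b| := by
  wlog h : a ≤ b generalizing a b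
  · rw [abs_sub_comm, abs_sub_comm a]
    exact this hb ha (le_of_not_ge h)
  have h1 : Real.exp (-b) ≤ Real.exp (-a) := Real.exp_le_exp.2 (by linarith)
  rw [abs_of_nonneg (by linarith), abs_sub_comm, abs_of_nonneg (by linarith)]
  have h2 : Real.exp (-b) = Real.exp (-a) * Real.exp (-(b - a)) := by
    rw [← Real.exp_add]; ring_nf
  have h3 := Real.one_sub_le_exp_neg (b - a)
  have h4 : Real.exp (-a) ≤ 1 := Real.exp_le_one_iff.2 (by linarith)
  have h5 := Real.exp_pos (-a)
  rw [h2]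
  nlinarith

variable {V : Type} [Fintype V] [DecidableEq V] {G : SimpleGraph V} {lam : ℝ}

lemma sum_weight_pos (hlam : 0 < lam) : 0 < ∑ σ : Finset V, weight G lam σ := by
  refine Finset.sum_pos' (fun σ _ => weight_nonneg G hlam σ) ⟨∅, Finset.mem_univ _, ?_⟩
  simp [weight, IsIndep]

lemma gibbs_nonneg (hlam : 0 < lam) (σ : Finset V) : 0 ≤ gibbs G lam σ :=
  div_nonneg (weight_nonneg G hlam σ) (sum_weight_pos hlam).le

lemma gibbsProb_mono (hlam : 0 < lam) {A B : Set (Finset V)} (h : A ⊆ B) :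
    gibbsProb G lam A ≤ gibbsProb G lam B := by
  refine Finset.sum_le_sum fun σ _ => ?_
  have := gibbs_nonneg (G := G) hlam σ
  by_cases hA : σ ∈ A
  · simp [hA, h hA]
  · by_cases hB : σ ∈ B <;> simp [hA, hB, this]

lemma gibbsProb_union_le (hlam : 0 < lam) (A B : Set (Finset V)) :
    gibbsProb G lam (A ∪ B) ≤ gibbsProb G lam A + gibbsProb G lam B := by
  unfold gibbsProb
  rw [← Finset.sum_add_distrib]
  refine Finset.sum_le_sum fun σ _ => ?_
  have := gibbs_nonneg (G := G) hlam σ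
  by_cases hA : σ ∈ A <;> by_cases hB : σ ∈ B <;> simp [hA, hB, this]

lemma gibbsProb_empty : gibbsProb G lam (∅ : Set (Finset V)) = 0 := by
  simp [gibbsProb]

lemma gibbsProb_biUnion_le (hlam : 0 < lam) (N : Finset V) (A : V → Set (Finset V)) :
    gibbsProb G lam (⋃ z ∈ N, A z) ≤ ∑ z ∈ N, gibbsProb G lam (A z) := by
  induction N using Finset.induction_on with
  | empty => simp [gibbsProb_empty]
  | insert a N ha ih =>
    rw [Finset.set_biUnion_insert, Finset.sum_insert ha]
    exact (gibbsProb_union_le hlam _ _).trans (by gcongr)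

lemma gibbsProb_compl (hlam : 0 < lam) (A : Set (Finset V)) :
    gibbsProb G lam A = 1 - gibbsProb G lam Aᶜ := by
  have h : gibbsProb G lam A + gibbsProb G lam Aᶜ = ∑ σ : Finset V, gibbs G lam σ := by
    unfold gibbsProb
    rw [← Finset.sum_add_distrib]
    refine Finset.sum_congr rfl fun σ _ => ?_
    by_cases hA : σ ∈ A <;> simp [hA]
  have h1 : ∑ σ : Finset V, gibbs G lam σ = 1 := by
    unfold gibbs
    rw [← Finset.sum_div]
    exact div_self (sum_weight_pos hlam).ne'
  linarith

/-- Markov's inequality for an exponential moment. -/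
lemma gibbsProb_le_of_sum_weight_mul_exp_le (hlam : 0 < lam) (f : Finset V → ℝ) (a M : ℝ)
    (h : ∑ σ : Finset V, weight G lam σ * Real.exp (f σ) ≤
      Real.exp M * ∑ σ : Finset V, weight G lam σ) :
    gibbsProb G lam {σ | a ≤ f σ} ≤ Real.exp (M - a) := by
  have hZ := sum_weight_pos (G := G) hlam
  have h1 : gibbsProb G lam {σ | a ≤ f σ} ≤
      ∑ σ : Finset V, Real.exp (-a) * (weight G lam σ * Real.exp (f σ)) /
        ∑ t : Finset V, weight G lam t := by
    refine Finset.sum_le_sum fun σ _ => ?_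
    have hw := weight_nonneg G hlam σ
    by_cases hσ : a ≤ f σ
    · rw [if_pos (by exact hσ), gibbs, mul_left_comm, ← Real.exp_add]
      have : 1 ≤ Real.exp (-a + f σ) := Real.one_le_exp (by linarith)
      gcongr
      exact le_mul_of_one_le_right hw this
    · rw [if_neg (by exact hσ)]
      positivity
  refine h1.trans ?_
  rw [← Finset.sum_div, ← Finset.mul_sum, div_le_iff₀ hZ, sub_eq_neg_add, Real.exp_add, mul_assoc]
  exact mul_le_mul_of_nonneg_left h (Real.exp_pos _).le

lemma emptyProb_le_one (hlam : 0 < lam) (D σ : Finset V) : emptyProb G lam D σ ≤ 1 :=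
  inv_le_one_of_one_le₀ (one_le_pow₀ (by linarith))

lemma emptyProb_eq_exp (hlam : 0 < lam) (D σ : Finset V) :
    emptyProb G lam D σ = Real.exp (-(Real.log (1 + lam) * (avail G D σ).card)) := by
  rw [emptyProb, Real.exp_neg, mul_comm, Real.exp_nat_mul, Real.exp_log (by linarith)]

variable [DecidableRel G.Adj]

lemma Ssum_eq_card (σ : Finset V) (v : V) :
    Ssum G σ v = ((G.neighborFinset v).filter
      fun z => σ ∩ (G.neighborFinset z).erase v = ∅).card := by
  simp [Ssum, unblockedInd, Finset.sum_boole]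

lemma Ssum_nonneg (σ : Finset V) (v : V) : 0 ≤ Ssum G σ v := by
  rw [Ssum_eq_card]
  positivity

/-- If `z` is unoccupied, then the conditional probability that `N(z) \ {v}` is empty is close to
`(1 + λ)^{-S(z)}`. -/
lemma abs_emptyProb_sub_exp_le (hlam : 0 < lam) (σ : Finset V) (v z : V) :
    |emptyProb G lam ((G.neighborFinset z).erase v) σ -
        Real.exp (-(Real.log (1 + lam) * Ssum G σ z))| ≤
      (if z ∈ σ then 1 else 0) + Real.log (1 + lam) := by
  have hθ : 0 ≤ Real.log (1 + lam) := Real.log_nonneg (by linarith)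
  have hS := Ssum_nonneg (G := G) σ z
  split_ifs with hz
  · have h1 := emptyProb_le_one (G := G) hlam ((G.neighborFinset z).erase v) σ
    have h2 : 0 ≤ emptyProb G lam ((G.neighborFinset z).erase v) σ := by
      unfold emptyProb; positivity
    have h3 := Real.exp_pos (-(Real.log (1 + lam) * Ssum G σ z))
    have h4 : Real.exp (-(Real.log (1 + lam) * Ssum G σ z)) ≤ 1 :=
      Real.exp_le_one_iff.2 (by nlinarith)
    rw [abs_le]
    constructor <;> linarith
  · rw [zero_add, emptyProb_eq_exp hlam]
    refine (abs_exp_neg_sub_exp_neg_le (by positivity) (by positivity)).trans ?_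
    rw [← mul_sub, abs_mul, abs_of_nonneg hθ]
    refine mul_le_of_le_one_right hθ ?_
    rw [Ssum_eq_card]
    set B := (G.neighborFinset z).filter fun y => σ ∩ (G.neighborFinset y).erase z = ∅
    have hav : avail G ((G.neighborFinset z).erase v) σ = B.erase v := by
      ext y
      simp only [avail, B, Finset.mem_filter, Finset.mem_erase, Finset.ext_iff, Finset.mem_inter,
        SimpleGraph.mem_neighborFinset, Finset.notMem_empty, iff_false, not_and, and_assoc]
      refine and_congr_right fun _ => and_congr_right fun _ => forall₂_congr fun u hu => ?_
      have huz : u ≠ z := fun h => hz (h ▸ hu)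
      simp [huz, SimpleGraph.adj_comm]
    rw [hav]
    have h1 : (B.erase v).card ≤ B.card := Finset.card_erase_le
    have h2 : B.card ≤ (B.erase v).card + 1 := by
      have := Finset.pred_card_le_card_erase (s := B) (a := v)
      omega
    have h1' : ((B.erase v).card : ℝ) ≤ B.card := by exact_mod_cast h1
    have h2' : (B.card : ℝ) ≤ (B.erase v).card + 1 := by exact_mod_cast h2
    rw [abs_le]
    constructor <;> linarith

/-- With high probability, `S(v)` is close to the sum of `(1 + λ)^{-S(z)}` over the neighbors
`z` of `v`. -/
lemma gibbsProb_abs_Ssum_sub_sum_exp_gt_le (hlam : 0 < lam) (hg : 6 ≤ G.egirth) {n : ℕ}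
    (hdeg : ∀ v, G.degree v ≤ n) (hlamn : lam * n ≤ 3) {η : ℝ} (hη0 : 0 < η) (hη1 : η ≤ 1)
    (hηn : 9 ≤ η * n) (v : V) :
    gibbsProb G lam {σ | η * n < |Ssum G σ v -
        ∑ z ∈ G.neighborFinset v, Real.exp (-(Real.log (1 + lam) * Ssum G σ z))|} ≤
      (2 + Real.exp 9) * Real.exp (-(η ^ 2 / 36 * n)) := by
  set N := G.neighborFinset v with hN
  have hNn : (N.card : ℝ) ≤ n := by
    rw [hN, SimpleGraph.card_neighborFinset_eq_degree]
    exact_mod_cast hdeg v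
  set X : Finset V → ℝ := fun σ => ∑ z ∈ N,
    ((if σ ∩ (G.neighborFinset z).erase v = ∅ then 1 else 0) -
      emptyProb G lam ((G.neighborFinset z).erase v) σ) with hX
  have hn0 : (0 : ℝ) ≤ n := Nat.cast_nonneg n
  have tail : ∀ r : ℝ, |r| = η / 6 →
      gibbsProb G lam {σ | η ^ 2 / 18 * n ≤ r * X σ} ≤ Real.exp (-(η ^ 2 / 36 * n)) := by
    intro r hr
    have h := sum_weight_mul_exp_empty_sub_le hlam N _ (pairwiseDisjoint_neighborFinset_erase hg v)
      (isIndep_biUnion_neighborFinset_erase hg v) (r := r) (by rw [hr]; linarith)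
    rw [← Real.exp_nat_mul] at h
    refine (gibbsProb_le_of_sum_weight_mul_exp_le hlam _ _ _ h).trans (Real.exp_le_exp.2 ?_)
    rw [← sq_abs r, hr]
    nlinarith [mul_le_mul_of_nonneg_right hNn (sq_nonneg η)]
  have occ : gibbsProb G lam {σ | η / 3 * n ≤ ((σ ∩ N).card : ℝ)} ≤
      Real.exp 9 * Real.exp (-(η ^ 2 / 36 * n)) := by
    refine (gibbsProb_le_of_sum_weight_mul_exp_le hlam _ _ _
      (sum_weight_mul_exp_card_inter_le hlam (isIndep_neighborFinset hg v))).trans ?_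
    rw [← Real.exp_add]
    apply Real.exp_le_exp.2
    have h1 : lam * N.card ≤ 3 := (mul_le_mul_of_nonneg_left hNn hlam.le).trans hlamn
    have h2 : η ^ 2 / 36 * n ≤ η / 3 * n := by
      apply mul_le_mul_of_nonneg_right _ hn0
      nlinarith
    linarith
  have hsub : {σ | η * n < |Ssum G σ v -
        ∑ z ∈ N, Real.exp (-(Real.log (1 + lam) * Ssum G σ z))|} ⊆
      ({σ | η ^ 2 / 18 * n ≤ η / 6 * X σ} ∪ {σ | η ^ 2 / 18 * n ≤ -(η / 6) * X σ}) ∪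
        {σ | η / 3 * n ≤ ((σ ∩ N).card : ℝ)} := by
    intro σ hσ
    by_contra hcon
    simp only [Set.mem_union, Set.mem_ofPred_eq, not_or, not_le] at hcon hσ
    obtain ⟨⟨h1, h2⟩, h3⟩ := hcon
    have hX1 : X σ < η / 3 * n := by
      by_contra! h
      nlinarith
    have hX2 : -(η / 3 * n) < X σ := by
      by_contra! h
      nlinarith
    have hθ : Real.log (1 + lam) ≤ lam := by
      have := Real.log_le_sub_one_of_pos (by linarith : 0 < 1 + lam)
      linarith
    have hdecomp : Ssum G σ v - ∑ z ∈ N, Real.exp (-(Real.log (1 + lam) * Ssum G σ z)) =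
        X σ + ∑ z ∈ N, (emptyProb G lam ((G.neighborFinset z).erase v) σ -
          Real.exp (-(Real.log (1 + lam) * Ssum G σ z))) := by
      simp only [hX, Ssum, unblockedInd, Finset.sum_sub_distrib, hN]
      ring
    have hrest : |∑ z ∈ N, (emptyProb G lam ((G.neighborFinset z).erase v) σ -
          Real.exp (-(Real.log (1 + lam) * Ssum G σ z)))| ≤ (σ ∩ N).card + 3 := by
      refine (Finset.abs_sum_le_sum_abs _ _).trans
        ((Finset.sum_le_sum fun z _ => abs_emptyProb_sub_exp_le hlam σ v z).trans ?_)
      rw [Finset.sum_add_distrib, Finset.sum_boole, Finset.sum_const, nsmul_eq_mul,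
        Finset.filter_mem_eq_inter, Finset.inter_comm]
      have : (N.card : ℝ) * Real.log (1 + lam) ≤ n * lam := by
        have := Real.log_nonneg (by linarith : 1 ≤ 1 + lam)
        gcongr
      linarith
    rw [hdecomp] at hσ
    rw [abs_le] at hrest
    have : |X σ + ∑ z ∈ N, (emptyProb G lam ((G.neighborFinset z).erase v) σ -
          Real.exp (-(Real.log (1 + lam) * Ssum G σ z)))| ≤ η * n := by
      rw [abs_le]
      constructor <;> linarith
    linarith
  refine (gibbsProb_mono hlam hsub).trans ?_
  refine (gibbsProb_union_le hlam _ _).trans ?_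
  have h1 := gibbsProb_union_le (G := G) hlam {σ | η ^ 2 / 18 * n ≤ η / 6 * X σ}
    {σ | η ^ 2 / 18 * n ≤ -(η / 6) * X σ}
  have h2 := tail (η / 6) (abs_of_pos (by linarith))
  have h3 := tail (-(η / 6)) (by rw [abs_neg]; exact abs_of_pos (by linarith))
  linarith

end Probability

section Contraction

lemma mul_exp_neg_le (T : ℝ) : T * Real.exp (-T) ≤ Real.exp (-1) := by
  have h := Real.add_one_le_exp (T - 1)
  have h2 : Real.exp (-1) = Real.exp (T - 1) * Real.exp (-T) := by
    rw [← Real.exp_add]; ring_nf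
  rw [h2]
  exact mul_le_mul_of_nonneg_right (by linarith) (Real.exp_pos _).le

variable {α : Type*} {θ κ : ℝ}

lemma mul_exp_mul_sum_le (hθ : 0 ≤ θ) (hκ : 0 ≤ κ) (N : Finset α)
    (hN : θ * N.card ≤ κ ^ 2 * Real.exp 1) (p : α → ℝ) :
    θ * Real.exp (-(θ / 2 * ∑ z ∈ N, p z ^ 2)) * ∑ z ∈ N, p z ≤ κ := by
  refine le_of_sq_le_sq ?_ hκ
  set P := ∑ z ∈ N, p z ^ 2 with hP
  have hP0 : 0 ≤ P := Finset.sum_nonneg fun z _ => sq_nonneg _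
  have hcs : (∑ z ∈ N, p z) ^ 2 ≤ N.card * P := sq_sum_le_card_mul_sum_sq
  have hexp : Real.exp (-(θ / 2 * P)) ^ 2 = Real.exp (-(θ * P)) := by
    rw [← Real.exp_nat_mul]; ring_nf
  have hee : Real.exp 1 * Real.exp (-1) = 1 := by rw [← Real.exp_add]; simp
  calc (θ * Real.exp (-(θ / 2 * P)) * ∑ z ∈ N, p z) ^ 2
      = θ ^ 2 * Real.exp (-(θ * P)) * (∑ z ∈ N, p z) ^ 2 := by rw [← hexp]; ring
    _ ≤ θ ^ 2 * Real.exp (-(θ * P)) * (N.card * P) := by gcongr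
    _ = (θ * N.card) * (θ * P * Real.exp (-(θ * P))) := by ring
    _ ≤ (κ ^ 2 * Real.exp 1) * Real.exp (-1) := by
        refine mul_le_mul hN (mul_exp_neg_le _) (by positivity) (by positivity)
    _ = κ ^ 2 := by rw [mul_assoc, hee, mul_one]

/-- In the coordinates `√ω`, the tree recursion contracts in the supremum norm. -/
lemma abs_exp_sub_exp_le (hθ : 0 ≤ θ) (hκ : 0 ≤ κ) (N : Finset α)
    (hN : θ * N.card ≤ κ ^ 2 * Real.exp 1) {s t : α → ℝ} (hs : ∀ z, 0 ≤ s z)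
    (ht : ∀ z, 0 ≤ t z) {M : ℝ} (hM : 0 ≤ M) (hst : ∀ z ∈ N, |s z - t z| ≤ M) :
    |Real.exp (-(θ / 2 * ∑ z ∈ N, s z ^ 2)) - Real.exp (-(θ / 2 * ∑ z ∈ N, t z ^ 2))| ≤
      κ * M := by
  set p : ℝ → α → ℝ := fun r z => t z + r * (s z - t z) with hp
  set g : ℝ → ℝ := fun r => Real.exp (-(θ / 2 * ∑ z ∈ N, p r z ^ 2)) with hg
  have hder : ∀ r : ℝ, HasDerivAt g
      (g r * -(θ / 2 * ∑ z ∈ N, 2 * p r z * (s z - t z))) r := by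
    intro r
    refine HasDerivAt.exp (HasDerivAt.neg (HasDerivAt.const_mul _ ?_))
    refine HasDerivAt.fun_sum fun z _ => ?_
    have h1 : HasDerivAt (fun r => p r z) (s z - t z) r := by
      simpa [hp] using ((hasDerivAt_id r).mul_const (s z - t z)).const_add (t z)
    simpa using h1.fun_pow 2
  have hbound : ∀ r ∈ Set.Icc (0 : ℝ) 1,
      ‖g r * -(θ / 2 * ∑ z ∈ N, 2 * p r z * (s z - t z))‖ ≤ κ * M := by
    intro r hr
    have hp0 : ∀ z, 0 ≤ p r z := fun z => by
      have : p r z = (1 - r) * t z + r * s z := by simp only [hp]; ring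
      rw [this]
      have := mul_nonneg (sub_nonneg.2 hr.2) (ht z)
      have := mul_nonneg hr.1 (hs z)
      linarith
    have h1 : |∑ z ∈ N, 2 * p r z * (s z - t z)| ≤ 2 * (∑ z ∈ N, p r z) * M := by
      refine (Finset.abs_sum_le_sum_abs _ _).trans ?_
      rw [Finset.mul_sum, Finset.sum_mul]
      refine Finset.sum_le_sum fun z hz => ?_
      have h0 : 0 ≤ 2 * p r z := by linarith [hp0 z]
      rw [abs_mul, abs_of_nonneg h0]
      exact mul_le_mul_of_nonneg_left (hst z hz) h0
    have hg0 : 0 ≤ g r := (Real.exp_pos _).le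
    rw [Real.norm_eq_abs, abs_mul, abs_neg, abs_mul, abs_of_nonneg hg0,
      abs_of_nonneg (by linarith : 0 ≤ θ / 2)]
    calc g r * (θ / 2 * |∑ z ∈ N, 2 * p r z * (s z - t z)|)
        ≤ g r * (θ / 2 * (2 * (∑ z ∈ N, p r z) * M)) := by gcongr
      _ = θ * g r * (∑ z ∈ N, p r z) * M := by ring
      _ ≤ κ * M := mul_le_mul_of_nonneg_right (mul_exp_mul_sum_le hθ hκ N hN (p r)) hM
  have := (convex_Icc (0 : ℝ) 1).norm_image_sub_le_of_norm_hasDerivWithin_le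
    (fun r _ => (hder r).hasDerivWithinAt) hbound (Set.left_mem_Icc.2 zero_le_one)
    (Set.right_mem_Icc.2 zero_le_one)
  simpa [hg, hp] using this

end Contraction

section Recursion

variable {V : Type} [Fintype V] [DecidableEq V] {G : SimpleGraph V} [DecidableRel G.Adj]
  {lam κ η : ℝ} {n : ℕ} {ω : V → ℝ}

lemma abs_log_one_add_mul_sub_le (hlam : 0 < lam) {w : ℝ} (hw : w ∈ Set.Icc (0 : ℝ) 1) :
    |Real.log (1 + lam * w) - Real.log (1 + lam) * w| ≤ lam ^ 2 := by
  obtain ⟨h0, h1⟩ := hw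
  have hlw : 0 ≤ lam * w := mul_nonneg hlam.le h0
  have a1 := Real.log_le_sub_one_of_pos (by linarith : 0 < 1 + lam)
  have a2 := Real.log_le_sub_one_of_pos (by linarith : 0 < 1 + lam * w)
  have key : ∀ x : ℝ, 0 ≤ x → x - x ^ 2 ≤ Real.log (1 + x) := by
    intro x hx
    have h := Real.one_sub_inv_le_log_of_pos (by linarith : 0 < 1 + x)
    have h2 : x - x ^ 2 ≤ 1 - (1 + x)⁻¹ := by
      have h3 : 1 - (1 + x)⁻¹ - (x - x ^ 2) = x ^ 3 * (1 + x)⁻¹ := by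
        field_simp
        ring
      have : 0 ≤ x ^ 3 * (1 + x)⁻¹ := by positivity
      linarith
    linarith
  have b1 := key lam hlam.le
  have b2 := key (lam * w) hlw
  have c1 := mul_le_mul_of_nonneg_right a1 h0
  have c2 := mul_le_mul_of_nonneg_right b1 h0
  have hww : w ^ 2 ≤ 1 := pow_le_one₀ h0 h1
  have d1 : (lam * w) ^ 2 ≤ lam ^ 2 := by
    rw [mul_pow]
    exact mul_le_of_le_one_right (sq_nonneg _) hww
  have d2 : lam ^ 2 * w ≤ lam ^ 2 := mul_le_of_le_one_right (sq_nonneg _) h1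
  rw [abs_le]
  constructor <;> linarith

lemma abs_fixedPoint_sub_exp_le (hlam : 0 < lam) (hdeg : ∀ v, G.degree v ≤ n)
    (hω : ∀ u, ω u ∈ Set.Icc (0 : ℝ) 1) (hfix : bpF G lam ω = ω) (v : V) :
    |ω v - Real.exp (-(Real.log (1 + lam) * ∑ z ∈ G.neighborFinset v, ω z))| ≤
      n * lam ^ 2 := by
  have hpos : ∀ z, 0 < 1 + lam * ω z := fun z => by
    have := mul_nonneg hlam.le (hω z).1
    linarith
  have h1 : ω v = Real.exp (-∑ z ∈ G.neighborFinset v, Real.log (1 + lam * ω z)) := by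
    conv_lhs => rw [← hfix]
    rw [bpF, ← Finset.sum_neg_distrib, Real.exp_sum]
    refine Finset.prod_congr rfl fun z _ => ?_
    rw [Real.exp_neg, Real.exp_log (hpos z)]
  have hθ := Real.log_nonneg (by linarith : 1 ≤ 1 + lam)
  rw [h1]
  refine (abs_exp_neg_sub_exp_neg_le (Finset.sum_nonneg fun z _ => Real.log_nonneg ?_)
    (mul_nonneg hθ (Finset.sum_nonneg fun z _ => (hω z).1))).trans ?_
  · have := mul_nonneg hlam.le (hω z).1
    linarith
  rw [Finset.mul_sum, ← Finset.sum_sub_distrib]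
  refine (Finset.abs_sum_le_sum_abs _ _).trans ((Finset.sum_le_sum fun z _ =>
    abs_log_one_add_mul_sub_le hlam (hω z)).trans ?_)
  rw [Finset.sum_const, nsmul_eq_mul, SimpleGraph.card_neighborFinset_eq_degree]
  have : (G.degree v : ℝ) ≤ n := by exact_mod_cast hdeg v
  gcongr

/-- The square root of `(1 + λ)^{-x}`. -/
def rootExp (lam x : ℝ) : ℝ := Real.exp (-(Real.log (1 + lam) / 2 * x))

lemma rootExp_sq (lam x : ℝ) : rootExp lam x ^ 2 = Real.exp (-(Real.log (1 + lam) * x)) := by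
  rw [rootExp, ← Real.exp_nat_mul]
  push_cast
  ring_nf

lemma rootExp_nonneg (lam x : ℝ) : 0 ≤ rootExp lam x := (Real.exp_pos _).le

lemma rootExp_le_one (hlam : 0 < lam) {x : ℝ} (hx : 0 ≤ x) : rootExp lam x ≤ 1 := by
  have := Real.log_nonneg (by linarith : 1 ≤ 1 + lam)
  exact Real.exp_le_one_iff.2 (by nlinarith)

lemma abs_rootExp_sub_le (hlam : 0 < lam) (hlamn : lam * n ≤ 3) {x y : ℝ} (hx : 0 ≤ x)
    (hy : 0 ≤ y) (hη : 0 ≤ η) (hxy : |x - y| ≤ η * n) :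
    |rootExp lam x - rootExp lam y| ≤ 3 / 2 * η := by
  have h0 := Real.log_nonneg (by linarith : 1 ≤ 1 + lam)
  have h1 := Real.log_le_sub_one_of_pos (by linarith : 0 < 1 + lam)
  refine (abs_exp_neg_sub_exp_neg_le (by positivity) (by positivity)).trans ?_
  rw [← mul_sub, abs_mul, abs_of_nonneg (by linarith : 0 ≤ Real.log (1 + lam) / 2)]
  calc Real.log (1 + lam) / 2 * |x - y| ≤ lam / 2 * (η * n) := by
        apply mul_le_mul (by linarith) hxy (abs_nonneg _) (by linarith)
    _ = (lam * n) * (η / 2) := by ring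
    _ ≤ 3 * (η / 2) := by gcongr
    _ = _ := by ring

/-- One step of the recursion for approximate solutions of the belief-propagation equations. -/
lemma abs_rootExp_sub_rootExp_le (hlam : 0 < lam) (hdeg : ∀ v, G.degree v ≤ n)
    (hlamn : lam * n ≤ 3) (hκ : 0 ≤ κ) (hκn : lam * n ≤ κ ^ 2 * Real.exp 1) (hη : 0 ≤ η)
    {a b : V → ℝ} (ha0 : ∀ z, 0 ≤ a z) (hb0 : ∀ z, 0 ≤ b z) (v : V)
    (ha : |a v - ∑ z ∈ G.neighborFinset v, rootExp lam (a z) ^ 2| ≤ η * n)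
    (hb : |b v - ∑ z ∈ G.neighborFinset v, rootExp lam (b z) ^ 2| ≤ η * n) {M : ℝ}
    (hM : 0 ≤ M)
    (h : ∀ z ∈ G.neighborFinset v, |rootExp lam (a z) - rootExp lam (b z)| ≤ M) :
    |rootExp lam (a v) - rootExp lam (b v)| ≤ κ * M + 3 * η := by
  have h1 := abs_rootExp_sub_le hlam hlamn (ha0 v)
    (Finset.sum_nonneg fun z _ => sq_nonneg _) hη ha
  have h2 := abs_rootExp_sub_le hlam hlamn (hb0 v)
    (Finset.sum_nonneg fun z _ => sq_nonneg _) hη hb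
  have hθ0 := Real.log_nonneg (by linarith : 1 ≤ 1 + lam)
  have hθ1 := Real.log_le_sub_one_of_pos (by linarith : 0 < 1 + lam)
  have hcard : ((G.neighborFinset v).card : ℝ) ≤ n := by
    rw [SimpleGraph.card_neighborFinset_eq_degree]
    exact_mod_cast hdeg v
  have hN : Real.log (1 + lam) * (G.neighborFinset v).card ≤ κ ^ 2 * Real.exp 1 :=
    (mul_le_mul (by linarith) hcard (Nat.cast_nonneg _) hlam.le).trans hκn
  have h3 := abs_exp_sub_exp_le hθ0 hκ _ hN (s := fun z => rootExp lam (a z))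
    (t := fun z => rootExp lam (b z)) (fun z => rootExp_nonneg _ _)
    (fun z => rootExp_nonneg _ _) hM h
  change |rootExp lam _ - rootExp lam _| ≤ _ at h3
  rw [abs_le] at *
  constructor <;> linarith

lemma abs_sum_fixedPoint_sub_le (hlam : 0 < lam) (hdeg : ∀ v, G.degree v ≤ n)
    (hlamn : lam * n ≤ 3) (hηn : 9 ≤ η * n)
    (hω : ∀ u, ω u ∈ Set.Icc (0 : ℝ) 1) (hfix : bpF G lam ω = ω) (v : V) :
    |∑ z ∈ G.neighborFinset v, ω z - ∑ z ∈ G.neighborFinset v,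
      rootExp lam (∑ u ∈ G.neighborFinset z, ω u) ^ 2| ≤ η * n := by
  have hcard : ((G.neighborFinset v).card : ℝ) ≤ n := by
    rw [SimpleGraph.card_neighborFinset_eq_degree]
    exact_mod_cast hdeg v
  simp only [rootExp_sq]
  rw [← Finset.sum_sub_distrib]
  refine (Finset.abs_sum_le_sum_abs _ _).trans ((Finset.sum_le_sum fun z _ =>
    abs_fixedPoint_sub_exp_le hlam hdeg hω hfix z).trans ?_)
  rw [Finset.sum_const, nsmul_eq_mul]
  calc ((G.neighborFinset v).card : ℝ) * (n * lam ^ 2) ≤ n * (n * lam ^ 2) := by gcongr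
    _ = (lam * n) ^ 2 := by ring
    _ ≤ 3 ^ 2 := by gcongr
    _ ≤ η * n := by linarith

lemma gibbsProb_abs_rootExp_sub_gt_le (hlam : 0 < lam) (hg : 6 ≤ G.egirth)
    (hdeg : ∀ v, G.degree v ≤ n) (hlamn : lam * n ≤ 3) (hκ0 : 0 ≤ κ) (hκ1 : κ < 1)
    (hκn : lam * n ≤ κ ^ 2 * Real.exp 1) (hη0 : 0 < η) (hη1 : η ≤ 1) (hηn : 9 ≤ η * n)
    (hω : ∀ u, ω u ∈ Set.Icc (0 : ℝ) 1) (hfix : bpF G lam ω = ω) (k : ℕ) (v : V) :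
    gibbsProb G lam {σ | κ ^ k + 3 * η / (1 - κ) <
        |rootExp lam (Ssum G σ v) - rootExp lam (∑ z ∈ G.neighborFinset v, ω z)|} ≤
      (2 + Real.exp 9) * Real.exp (-(η ^ 2 / 36 * n)) * (1 + n) ^ k := by
  have hc : 0 ≤ 3 * η / (1 - κ) := div_nonneg (by linarith) (by linarith)
  have hc' : κ * (3 * η / (1 - κ)) + 3 * η = 3 * η / (1 - κ) := by
    have : 1 - κ ≠ 0 := by linarith
    field_simp
    ring
  set c := 3 * η / (1 - κ)
  set p := (2 + Real.exp 9) * Real.exp (-(η ^ 2 / 36 * n)) with hp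
  have hp0 : 0 ≤ p := by positivity
  have hb0 : ∀ v, 0 ≤ ∑ z ∈ G.neighborFinset v, ω z := fun v =>
    Finset.sum_nonneg fun z _ => (hω z).1
  induction k generalizing v with
  | zero =>
    have : {σ | κ ^ 0 + c < |rootExp lam (Ssum G σ v) -
        rootExp lam (∑ z ∈ G.neighborFinset v, ω z)|} = ∅ := by
      refine Set.eq_empty_of_forall_notMem fun σ hσ => ?_
      rw [Set.mem_ofPred_eq, pow_zero] at hσ
      have h1 := rootExp_nonneg lam (Ssum G σ v)
      have h2 := rootExp_le_one hlam (Ssum_nonneg (G := G) σ v)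
      have h3 := rootExp_nonneg lam (∑ z ∈ G.neighborFinset v, ω z)
      have h4 := rootExp_le_one hlam (hb0 v)
      have : |rootExp lam (Ssum G σ v) -
        rootExp lam (∑ z ∈ G.neighborFinset v, ω z)| ≤ 1 := by
        rw [abs_le]
        constructor <;> linarith
      linarith
    rw [this, gibbsProb_empty]
    positivity
  | succ k ih =>
    have hsub : {σ | κ ^ (k + 1) + c < |rootExp lam (Ssum G σ v) -
          rootExp lam (∑ z ∈ G.neighborFinset v, ω z)|} ⊆
        {σ | η * n < |Ssum G σ v -
          ∑ z ∈ G.neighborFinset v, Real.exp (-(Real.log (1 + lam) * Ssum G σ z))|} ∪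
        ⋃ z ∈ G.neighborFinset v, {σ | κ ^ k + c < |rootExp lam (Ssum G σ z) -
          rootExp lam (∑ u ∈ G.neighborFinset z, ω u)|} := by
      intro σ hσ
      by_contra hcon
      simp only [Set.mem_union, Set.mem_iUnion, Set.mem_ofPred_eq, not_or, not_exists,
        not_lt] at hcon hσ
      obtain ⟨h1, h2⟩ := hcon
      simp only [← rootExp_sq] at h1
      have := abs_rootExp_sub_rootExp_le hlam hdeg hlamn hκ0 hκn hη0.le
        (Ssum_nonneg (G := G) σ) hb0 v h1
        (abs_sum_fixedPoint_sub_le hlam hdeg hlamn hηn hω hfix v) (by positivity) h2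
      rw [mul_add, add_assoc, hc', ← pow_succ'] at this
      linarith
    refine (gibbsProb_mono hlam hsub).trans ((gibbsProb_union_le hlam _ _).trans ?_)
    have h1 := gibbsProb_abs_Ssum_sub_sum_exp_gt_le hlam hg hdeg hlamn hη0 hη1 hηn v
    have h2 := (gibbsProb_biUnion_le hlam (G.neighborFinset v) fun z =>
      {σ | κ ^ k + c < |rootExp lam (Ssum G σ z) -
          rootExp lam (∑ u ∈ G.neighborFinset z, ω u)|}).trans
      (Finset.sum_le_sum fun z _ => ih z)
    rw [Finset.sum_const, nsmul_eq_mul, SimpleGraph.card_neighborFinset_eq_degree] at h2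
    have h3 : (G.degree v : ℝ) * (p * (1 + n) ^ k) ≤ n * (p * (1 + n) ^ k) := by
      have : (G.degree v : ℝ) ≤ n := by exact_mod_cast hdeg v
      gcongr
    have h4 : p ≤ p * (1 + n) ^ k :=
      le_mul_of_one_le_right hp0 (one_le_pow₀ (by linarith [(Nat.cast_nonneg n : (0 : ℝ) ≤ n)]))
    calc _ ≤ p + n * (p * (1 + n) ^ k) := add_le_add h1 (h2.trans h3)
      _ ≤ p * (1 + n) ^ k + n * (p * (1 + n) ^ k) := by gcongr
      _ = _ := by ring

lemma gibbsProb_abs_Ssum_sub_sum_fixedPoint_gt_le (hlam : 0 < lam) (hg : 6 ≤ G.egirth)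
    (hdeg : ∀ v, G.degree v ≤ n) (hlamn : lam * n ≤ 3) (hκ0 : 0 ≤ κ) (hκ1 : κ < 1)
    (hκn : lam * n ≤ κ ^ 2 * Real.exp 1) (hη0 : 0 < η) (hη1 : η ≤ 1) (hηn : 9 ≤ η * n)
    (hω : ∀ u, ω u ∈ Set.Icc (0 : ℝ) 1) (hfix : bpF G lam ω = ω) (k : ℕ) (v : V) {ε : ℝ}
    (hε : 2 * η + 2 * (κ ^ k + 3 * η / (1 - κ)) ≤ ε) :
    gibbsProb G lam {σ | ε * n < |Ssum G σ v - ∑ z ∈ G.neighborFinset v, ω z|} ≤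
      (2 + Real.exp 9) * Real.exp (-(η ^ 2 / 36 * n)) * (1 + n) ^ (k + 1) := by
  set c := 3 * η / (1 - κ)
  have hc : 0 ≤ c := div_nonneg (by linarith) (by linarith)
  set p := (2 + Real.exp 9) * Real.exp (-(η ^ 2 / 36 * n)) with hp
  have hp0 : 0 ≤ p := by positivity
  have hcard : ((G.neighborFinset v).card : ℝ) ≤ n := by
    rw [SimpleGraph.card_neighborFinset_eq_degree]
    exact_mod_cast hdeg v
  have hb0 : ∀ v, 0 ≤ ∑ z ∈ G.neighborFinset v, ω z := fun v =>
    Finset.sum_nonneg fun z _ => (hω z).1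
  have hsub : {σ | ε * n < |Ssum G σ v - ∑ z ∈ G.neighborFinset v, ω z|} ⊆
      {σ | η * n < |Ssum G σ v -
        ∑ z ∈ G.neighborFinset v, Real.exp (-(Real.log (1 + lam) * Ssum G σ z))|} ∪
      ⋃ z ∈ G.neighborFinset v, {σ | κ ^ k + c < |rootExp lam (Ssum G σ z) -
        rootExp lam (∑ u ∈ G.neighborFinset z, ω u)|} := by
    intro σ hσ
    by_contra hcon
    simp only [Set.mem_union, Set.mem_iUnion, Set.mem_ofPred_eq, not_or, not_exists,
      not_lt] at hcon hσ
    obtain ⟨h1, h2⟩ := hcon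
    simp only [← rootExp_sq] at h1
    have h3 := abs_sum_fixedPoint_sub_le hlam hdeg hlamn hηn hω hfix v
    have h4 : |∑ z ∈ G.neighborFinset v, rootExp lam (Ssum G σ z) ^ 2 -
        ∑ z ∈ G.neighborFinset v, rootExp lam (∑ u ∈ G.neighborFinset z, ω u) ^ 2| ≤
        2 * (κ ^ k + c) * n := by
      rw [← Finset.sum_sub_distrib]
      refine (Finset.abs_sum_le_sum_abs _ _).trans
        ((Finset.sum_le_sum (g := fun _ => 2 * (κ ^ k + c)) fun z hz => ?_).trans ?_)
      · have a1 := rootExp_nonneg lam (Ssum G σ z)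
        have a2 := rootExp_le_one hlam (Ssum_nonneg (G := G) σ z)
        have a3 := rootExp_nonneg lam (∑ u ∈ G.neighborFinset z, ω u)
        have a4 := rootExp_le_one hlam (hb0 z)
        rw [sq_sub_sq, abs_mul, abs_of_nonneg (by linarith)]
        exact mul_le_mul (by linarith) (h2 z hz) (abs_nonneg _) (by norm_num)
      · rw [Finset.sum_const, nsmul_eq_mul, mul_comm]
        gcongr
    have h5 := mul_le_mul_of_nonneg_right hε (Nat.cast_nonneg n : (0 : ℝ) ≤ n)
    have h6 : |Ssum G σ v - ∑ z ∈ G.neighborFinset v, ω z| ≤ ε * n := by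
      rw [abs_le] at *
      constructor <;> linarith
    linarith
  refine (gibbsProb_mono hlam hsub).trans ((gibbsProb_union_le hlam _ _).trans ?_)
  have h1 := gibbsProb_abs_Ssum_sub_sum_exp_gt_le hlam hg hdeg hlamn hη0 hη1 hηn v
  have h2 := (gibbsProb_biUnion_le hlam (G.neighborFinset v) fun z =>
    {σ | κ ^ k + c < |rootExp lam (Ssum G σ z) -
        rootExp lam (∑ u ∈ G.neighborFinset z, ω u)|}).trans
    (Finset.sum_le_sum fun z _ => gibbsProb_abs_rootExp_sub_gt_le hlam hg hdeg hlamn hκ0 hκ1 hκn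
      hη0 hη1 hηn hω hfix k z)
  rw [Finset.sum_const, nsmul_eq_mul] at h2
  have h3 : ((G.neighborFinset v).card : ℝ) * (p * (1 + n) ^ k) ≤ n * (p * (1 + n) ^ k) := by
    gcongr
  have h4 : p ≤ p * (1 + n) ^ k :=
    le_mul_of_one_le_right hp0 (one_le_pow₀ (by linarith [(Nat.cast_nonneg n : (0 : ℝ) ≤ n)]))
  calc _ ≤ p + n * (p * (1 + n) ^ k) := add_le_add h1 (h2.trans h3)
    _ ≤ p * (1 + n) ^ k + n * (p * (1 + n) ^ k) := by gcongr
    _ = _ := by ring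

end Recursion

section Asymptotics

lemma lambdaC_pos_s6 {D : ℕ} (hD : 3 ≤ D) : 0 < lambdaC D := by
  have : (3 : ℝ) ≤ D := by exact_mod_cast hD
  exact div_pos (pow_pos (by linarith) _) (pow_pos (by linarith) _)

lemma lambdaC_mul_le {δ : ℝ} (hδ0 : 0 < δ) (hδ1 : δ < 1) {D : ℕ} (hD : 10 / δ + 2 ≤ D) :
    (1 - δ) * lambdaC D * D ≤ (1 - δ / 2) * Real.exp 1 := by
  have hx10 : 10 ≤ 10 / δ := by
    rw [le_div_iff₀ hδ0]
    linarith
  obtain ⟨m, rfl⟩ : ∃ m : ℕ, D = m + 2 := by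
    have : (2 : ℝ) ≤ D := by linarith
    exact ⟨D - 2, by have : 2 ≤ D := by exact_mod_cast this
                     omega⟩
  push_cast at hD
  have hm : 10 / δ ≤ m := by linarith
  have hm1 : (10 : ℝ) ≤ m := by linarith
  have hm0 : (0 : ℝ) < m := by linarith
  have hδm : 10 ≤ δ * m := by
    rw [div_le_iff₀ hδ0] at hm
    linarith
  have hlc : lambdaC (m + 2) * ((m + 2 : ℕ) : ℝ) =
      (1 + (m : ℝ)⁻¹) ^ m * ((m + 1) * (m + 2) / m ^ 2) := by
    have h1 : (1 + (m : ℝ)⁻¹) = (m + 1) / m := by field_simp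
    have h2 : ((m + 2 : ℕ) : ℝ) - 1 = m + 1 := by push_cast; ring
    have h3 : ((m + 2 : ℕ) : ℝ) - 2 = m := by push_cast; ring
    rw [lambdaC, h1, h2, h3, div_pow, show m + 2 - 1 = m + 1 by omega, pow_succ, pow_add]
    push_cast
    field_simp
  have he : (1 + (m : ℝ)⁻¹) ^ m ≤ Real.exp 1 := by
    calc (1 + (m : ℝ)⁻¹) ^ m ≤ Real.exp ((m : ℝ)⁻¹) ^ m := by
          apply pow_le_pow_left₀ (by positivity)
          linarith [Real.add_one_le_exp ((m : ℝ)⁻¹)]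
      _ = Real.exp 1 := by
          rw [← Real.exp_nat_mul, mul_inv_cancel₀ hm0.ne']
  have hrat : (1 - δ) * ((m + 1) * (m + 2) / m ^ 2) ≤ 1 - δ / 2 := by
    rw [← mul_div_assoc, div_le_iff₀ (by positivity)]
    nlinarith
  rw [mul_assoc, hlc]
  calc (1 - δ) * ((1 + (m : ℝ)⁻¹) ^ m * ((m + 1) * (m + 2) / m ^ 2))
      = ((1 - δ) * ((m + 1) * (m + 2) / m ^ 2)) * (1 + (m : ℝ)⁻¹) ^ m := by ring
    _ ≤ (1 - δ / 2) * Real.exp 1 := by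
        apply mul_le_mul hrat he (by positivity) (by linarith)

lemma exists_forall_mul_exp_mul_pow_le (K : ℝ) {c : ℝ} (hc : 0 < c) (k : ℕ) :
    ∃ n₀ : ℕ, ∀ n : ℕ, n₀ ≤ n →
      K * Real.exp (-(c * n)) * (1 + n) ^ k ≤ Real.exp (-(n : ℝ) / (2 / c)) := by
  have h1 : Filter.Tendsto (fun n : ℕ => (1 + n : ℝ) ^ k * Real.exp (-(c / 2) * (1 + n)))
      Filter.atTop (nhds 0) := by
    have h := (tendsto_rpow_mul_exp_neg_mul_atTop_nhds_zero k (c / 2) (by positivity)).comp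
      (Filter.tendsto_atTop_add_const_left _ (1 : ℝ) (tendsto_natCast_atTop_atTop (R := ℝ)))
    simpa only [Function.comp_def, Real.rpow_natCast] using h
  have h2 := h1.const_mul (K * Real.exp (c / 2))
  rw [mul_zero] at h2
  obtain ⟨n₀, hn₀⟩ := Filter.eventually_atTop.1 (h2.eventually_le_const one_pos)
  refine ⟨n₀, fun n hn => ?_⟩
  have h3 := mul_le_mul_of_nonneg_right (hn₀ n hn) (Real.exp_pos (-(c / 2 * n))).le
  have e1 : Real.exp (-(c * n)) =
      Real.exp (c / 2) * Real.exp (-(c / 2) * (1 + n)) * Real.exp (-(c / 2 * n)) := by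
    rw [← Real.exp_add, ← Real.exp_add]
    ring_nf
  have e2 : -(n : ℝ) / (2 / c) = -(c / 2 * n) := by field_simp
  rw [e1, e2]
  linarith

end Asymptotics

end HardCore

open HardCore

theorem gibbs_local_uniformity :
    ∀ δ ε : ℝ, 0 < δ → 0 < ε →
    ∃ (Δ₀ : ℕ) (C : ℝ), 0 < C ∧
      ∀ (V : Type) [Fintype V] [DecidableEq V] (G : SimpleGraph V) [DecidableRel G.Adj]
        (Δ : ℕ) (lam : ℝ),
        G.maxDegree = Δ → Δ₀ ≤ Δ → 6 ≤ G.egirth →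
        0 < lam → lam < (1 - δ) * lambdaC Δ →
        ∀ ωstar : V → ℝ, (∀ u : V, ωstar u ∈ Set.Icc (0 : ℝ) 1) →
          bpF G lam ωstar = ωstar →
        ∀ v : V,
          gibbsProb G lam
              {σ : Finset V | |Ssum G σ v - ∑ z ∈ G.neighborFinset v, ωstar z| ≤ ε * Δ}
            ≥ 1 - Real.exp (-(Δ : ℝ) / C) := by
  intro δ ε hδ hε
  set d := min δ (1 / 2) with hd
  have hd0 : 0 < d := lt_min hδ (by norm_num)
  have hd1 : d ≤ 1 / 2 := min_le_right _ _
  set κ := Real.sqrt (1 - d / 2) with hκ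
  have hκsq : κ ^ 2 = 1 - d / 2 := Real.sq_sqrt (by linarith)
  have hκ0 : 0 ≤ κ := Real.sqrt_nonneg _
  have hκ1 : κ < 1 := by nlinarith
  obtain ⟨k, hk⟩ := exists_pow_lt_of_lt_one (by linarith : 0 < ε / 4) hκ1
  set η := min 1 (ε * (1 - κ) / 16) with hη
  have h1κ : 0 < 1 - κ := by linarith
  have hη0 : 0 < η := lt_min one_pos (by positivity)
  have hη1 : η ≤ 1 := min_le_left _ _
  have hη2 : η ≤ ε * (1 - κ) / 16 := min_le_right _ _
  have hε' : 2 * η + 2 * (κ ^ k + 3 * η / (1 - κ)) ≤ ε := by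
    have h1 : 3 * η / (1 - κ) ≤ 3 * ε / 16 := by
      rw [div_le_iff₀ h1κ]
      linarith
    have h2 : ε * (1 - κ) ≤ ε := mul_le_of_le_one_right hε.le (by linarith)
    linarith
  obtain ⟨n₀, hn₀⟩ := exists_forall_mul_exp_mul_pow_le (2 + Real.exp 9)
    (by positivity : 0 < η ^ 2 / 36) (k + 1)
  refine ⟨max n₀ (max 3 (max ⌈10 / d + 2⌉₊ ⌈9 / η⌉₊)), 2 / (η ^ 2 / 36), by positivity, ?_⟩
  intro V _ _ G _ Δ lam hΔ hΔ₀ hg hlam hlamlt ω hω hfix v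
  simp only [max_le_iff, Nat.ceil_le] at hΔ₀
  obtain ⟨hΔ1, hΔ2, hΔ3, hΔ4⟩ := hΔ₀
  have hηn : 9 ≤ η * Δ := by
    rw [div_le_iff₀ hη0] at hΔ4
    linarith
  have hlam2 : lam ≤ (1 - d) * lambdaC Δ := hlamlt.le.trans
    (mul_le_mul_of_nonneg_right (by linarith [min_le_left δ (1 / 2)]) (lambdaC_pos_s6 hΔ2).le)
  have hκn : lam * Δ ≤ κ ^ 2 * Real.exp 1 := by
    rw [hκsq]
    exact (mul_le_mul_of_nonneg_right hlam2 (Nat.cast_nonneg _)).trans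
      (lambdaC_mul_le hd0 (by linarith) hΔ3)
  have hlamn : lam * Δ ≤ 3 := by
    have := Real.exp_one_lt_d9
    have := Real.exp_pos 1
    nlinarith
  have hdeg : ∀ v, G.degree v ≤ Δ := fun v => hΔ ▸ G.degree_le_maxDegree v
  have hbad := (gibbsProb_abs_Ssum_sub_sum_fixedPoint_gt_le hlam hg hdeg hlamn hκ0 hκ1 hκn hη0
    hη1 hηn hω hfix k v hε').trans (hn₀ Δ hΔ1)
  rw [gibbsProb_compl hlam]
  have hcompl : {σ : Finset V | |Ssum G σ v - ∑ z ∈ G.neighborFinset v, ω z| ≤ ε * Δ}ᶜ =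
      {σ | ε * Δ < |Ssum G σ v - ∑ z ∈ G.neighborFinset v, ω z|} := by
    ext σ
    simp
  rw [hcompl]
  linarith
end
end

section
/- For all δ>0 there exists Δ₀=Δ₀(δ) such that for all Δ≥Δ₀ and all 0<λ<(1−δ)·λ_c(Δ): for any x₁,x₂ ∈ [(1+λ)^{−Δ}, 1], (1/3)·|x₁−x₂| ≤ |Ψ(x₁)−Ψ(x₂)| ≤ 3·|x₁−x₂|, where Ψ(x) = (1/√λ)·arcsinh(√(λx)). -/
noncomputable section

open HardCore

theorem lambdaC_mul_le {D : ℕ} (hD : 100 ≤ D) : lambdaC D * D ≤ 3 := by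
  obtain ⟨m, rfl⟩ : ∃ m, D = m + 2 := ⟨D - 2, by omega⟩
  have hm : (98 : ℝ) ≤ m := by exact_mod_cast (by omega : 98 ≤ m)
  have hm0 : (0 : ℝ) < m := by linarith
  have h_rw : lambdaC (m + 2) * ((m + 2 : ℕ) : ℝ) =
      (1 / (m : ℝ) + 1) ^ (m + 1) * (1 + 2 / (m : ℝ)) := by
    have h : 1 / (m : ℝ) + 1 = (m + 1) / m := by field_simp; ring
    have e₁ : ((m + 2 : ℕ) : ℝ) - 1 = m + 1 := by push_cast; ring
    have e₂ : ((m + 2 : ℕ) : ℝ) - 2 = m := by push_cast; ring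
    rw [h, lambdaC, e₁, e₂, show m + 2 - 1 = m + 1 from rfl, div_pow, pow_succ _ (m + 1)]
    push_cast
    field_simp
  have h_inv : 1 / (m : ℝ) ≤ 1 / 98 := one_div_le_one_div_of_le (by norm_num) hm
  have h_inv0 : 0 < 1 / (m : ℝ) := by positivity
  have h_pow : (1 / (m : ℝ) + 1) ^ (m + 1) ≤ Real.exp 1 * Real.exp (1 / 98) := by
    calc (1 / (m : ℝ) + 1) ^ (m + 1) ≤ Real.exp (1 / m) ^ (m + 1) := by
          gcongr
          exact Real.add_one_le_exp _
      _ = Real.exp (1 + 1 / m) := by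
          rw [← Real.exp_nat_mul]
          congr 1
          push_cast
          field_simp
      _ ≤ Real.exp (1 + 1 / 98) := by gcongr
      _ = _ := Real.exp_add _ _
  have h_exp : Real.exp (1 / 98) ≤ 98 / 97 := by
    have h₁ := Real.add_one_le_exp (-(1 / 98) : ℝ)
    have h₂ : Real.exp (-(1 / 98)) * Real.exp (1 / 98) = 1 := by
      rw [← Real.exp_add]
      simp
    nlinarith [Real.exp_pos (1 / 98)]
  have h_pow' : (1 / (m : ℝ) + 1) ^ (m + 1) ≤ 2.7182818286 * (98 / 97) :=
    h_pow.trans (mul_le_mul Real.exp_one_lt_d9.le h_exp (Real.exp_pos _).le (by norm_num))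
  rw [h_rw]
  calc _ ≤ 2.7182818286 * (98 / 97) * (1 + 2 / 98 : ℝ) := by
        gcongr
    _ ≤ 3 := by norm_num

theorem hasDerivAt_Psi {lam x : ℝ} (hl : 0 < lam) (hx : 0 < x) :
    HasDerivAt (Psi lam) ((2 * √(x * (1 + lam * x)))⁻¹) x := by
  have hlx : 0 < lam * x := mul_pos hl hx
  have h := ((((hasDerivAt_id x).const_mul lam).sqrt hlx.ne').arsinh).const_mul (√lam)⁻¹
  refine h.congr_deriv ?_
  have h₁ : 0 < √lam := Real.sqrt_pos.2 hl
  have h₂ : 0 < √x := Real.sqrt_pos.2 hx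
  have h₃ : 0 < √(1 + lam * x) := Real.sqrt_pos.2 (by positivity)
  have h₄ : √lam ^ 2 = lam := Real.sq_sqrt hl.le
  simp only [id, smul_eq_mul, mul_one]
  rw [Real.sq_sqrt hlx.le, Real.sqrt_mul hl.le, Real.sqrt_mul hx.le]
  field_simp
  exact h₄.symm

theorem Psi_sub_bounds {lam a x y : ℝ} (hl : 0 < lam) (hl1 : lam ≤ 1) (ha : 1 / 36 ≤ a)
    (hax : a ≤ x) (hxy : x < y) (hy : y ≤ 1) :
    (1 / 3) * |x - y| ≤ |Psi lam x - Psi lam y| ∧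
      |Psi lam x - Psi lam y| ≤ 3 * |x - y| := by
  obtain ⟨c, hc, h_slope⟩ := exists_hasDerivAt_eq_slope (Psi lam)
    (fun z => (2 * √(z * (1 + lam * z)))⁻¹) hxy
    (fun z hz => (hasDerivAt_Psi hl (by linarith [hz.1])).continuousAt.continuousWithinAt)
    (fun z hz => hasDerivAt_Psi hl (by linarith [hz.1]))
  have hc36 : 1 / 36 ≤ c := by linarith [hc.1]
  have hc1 : c ≤ 1 := by linarith [hc.2]
  have h_lo : 1 / 6 ≤ √(c * (1 + lam * c)) := by
    apply Real.le_sqrt_of_sq_le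
    nlinarith [mul_pos hl (by linarith : 0 < c)]
  have h_hi : √(c * (1 + lam * c)) ≤ 3 / 2 := by
    apply Real.sqrt_le_iff.2 ⟨by norm_num, ?_⟩
    have : lam * c ≤ 1 := mul_le_one₀ hl1 (by linarith) hc1
    nlinarith [mul_pos hl (by linarith : 0 < c)]
  have h_eq : Psi lam y - Psi lam x = (2 * √(c * (1 + lam * c)))⁻¹ * (y - x) := by
    rw [h_slope, div_mul_cancel₀ _ (sub_pos.2 hxy).ne']
  rw [abs_sub_comm x, abs_sub_comm (Psi lam x), h_eq, abs_mul, abs_of_pos (a := (_)⁻¹)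
    (by positivity)]
  constructor
  · gcongr
    rw [one_div]
    exact inv_anti₀ (by positivity) (by linarith)
  · gcongr
    rw [← inv_inv (3 : ℝ)]
    exact inv_anti₀ (by norm_num) (by linarith)

theorem psi_bilipschitz :
    ∀ δ : ℝ, 0 < δ →
    ∃ Δ₀ : ℕ, ∀ (Δ : ℕ) (lam : ℝ),
      Δ₀ ≤ Δ → 0 < lam → lam < (1 - δ) * lambdaC Δ →
      ∀ x₁ x₂ : ℝ,
        x₁ ∈ Set.Icc (((1 + lam) ^ Δ)⁻¹) 1 → x₂ ∈ Set.Icc (((1 + lam) ^ Δ)⁻¹) 1 →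
        (1 / 3) * |x₁ - x₂| ≤ |Psi lam x₁ - Psi lam x₂| ∧
          |Psi lam x₁ - Psi lam x₂| ≤ 3 * |x₁ - x₂| := by
  intro δ hδ
  refine ⟨100, fun D lam hD hl h_lam x₁ x₂ h₁ h₂ => ?_⟩
  have hD' : (100 : ℝ) ≤ D := by exact_mod_cast hD
  have h_crit := lambdaC_mul_le hD
  have h_crit0 : 0 ≤ lambdaC D := by
    have e₁ : (0 : ℝ) ≤ (D : ℝ) - 1 := by linarith
    have e₂ : (0 : ℝ) ≤ (D : ℝ) - 2 := by linarith
    unfold lambdaC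
    positivity
  have h_le : lam ≤ lambdaC D := by nlinarith
  have h_mul : D * lam ≤ 3 := by nlinarith
  have hl1 : lam ≤ 1 := by nlinarith
  have ha : 1 / 36 ≤ ((1 + lam) ^ D)⁻¹ := by
    rw [one_div]
    apply inv_anti₀ (by positivity)
    calc (1 + lam) ^ D ≤ Real.exp lam ^ D := by
          gcongr
          linarith [Real.add_one_le_exp lam]
      _ = Real.exp (D * lam) := (Real.exp_nat_mul _ _).symm
      _ ≤ Real.exp ((3 : ℕ) * 1) := by
          apply Real.exp_le_exp.2
          simpa using h_mul
      _ = Real.exp 1 ^ 3 := Real.exp_nat_mul _ _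
      _ ≤ 2.7182818286 ^ 3 := by
          gcongr
          exact Real.exp_one_lt_d9.le
      _ ≤ 36 := by norm_num
  rcases lt_trichotomy x₁ x₂ with h | rfl | h
  · exact Psi_sub_bounds hl hl1 ha h₁.1 h h₂.2
  · simp
  · rw [abs_sub_comm x₁, abs_sub_comm (Psi lam x₁)]
    exact Psi_sub_bounds hl hl1 ha h₂.1 h h₁.2
end
end

section
/- For all δ>0 there exists Δ₀=Δ₀(δ) such that for all Δ≥Δ₀ and all 0<λ<(1−δ)·λ_c(Δ), it holds that α(λ,Δ) ≤ 1−δ/6. -/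
noncomputable section

open HardCore

open Filter Topology

/-- Upper bound for `Δ * lambdaC Δ`, asymptotically sharp since the right side tends to `exp 1`. -/
theorem HardCore.natCast_mul_lambdaC_le {n : ℕ} (hn : 3 ≤ n) :
    (n : ℝ) * lambdaC n ≤ (n : ℝ) / (n + (-1)) * Real.exp ((n : ℝ) / (n + (-2))) := by
  have hn' : (3 : ℝ) ≤ n := by exact_mod_cast hn
  have h1 : (0 : ℝ) < n - 1 := by linarith
  have h2 : (0 : ℝ) < n - 2 := by linarith
  have hpow : ((n : ℝ) - 1) ^ n = ((n : ℝ) - 1) ^ (n - 1) * ((n : ℝ) - 1) := by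
    rw [← pow_succ, Nat.sub_add_cancel (by omega)]
  have heq : (n : ℝ) * lambdaC n =
      (n : ℝ) / (n + (-1)) * (((n : ℝ) - 1) / (n - 2)) ^ n := by
    rw [lambdaC, div_pow, hpow, ← sub_eq_add_neg]
    field_simp
  rw [heq]
  have h3 : (0 : ℝ) < n + (-1) := by linarith
  have hbase : ((n : ℝ) - 1) / (n - 2) ≤ Real.exp (1 / ((n : ℝ) - 2)) := by
    have h := Real.add_one_le_exp (1 / ((n : ℝ) - 2))
    have : ((n : ℝ) - 1) / (n - 2) = 1 / ((n : ℝ) - 2) + 1 := by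
      field_simp
      ring
    rwa [this]
  have hexp : Real.exp ((n : ℝ) / (n + (-2))) = Real.exp (1 / ((n : ℝ) - 2)) ^ n := by
    rw [← Real.exp_nat_mul, ← sub_eq_add_neg, mul_one_div]
  rw [hexp]
  gcongr

/-- If `n * y / (1 + y)` is at least `s`, then `n * y * (1 + y) ^ n` is at least
`s * exp s`. -/
theorem HardCore.mul_exp_le_mul_one_add_pow {n : ℕ} {y s : ℝ} (hy : 0 ≤ y)
    (h : s ≤ n * y / (1 + y)) : s * Real.exp s ≤ n * y * (1 + y) ^ n := by
  have hy1 : 0 < 1 + y := by linarith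
  have hny : s ≤ n * y := h.trans (div_le_self (by positivity) (by linarith))
  have hbase : Real.exp (y / (1 + y)) ≤ 1 + y := by
    have h' := Real.add_one_le_exp (-(y / (1 + y)))
    have : -(y / (1 + y)) + 1 = (1 + y)⁻¹ := by
      field_simp
      ring
    rw [this, Real.exp_neg] at h'
    exact (inv_le_inv₀ hy1 (Real.exp_pos _)).mp h'
  have hexp : Real.exp s ≤ (1 + y) ^ n := by
    calc Real.exp s ≤ Real.exp (n * (y / (1 + y))) := by
          rw [← mul_div_assoc]
          exact Real.exp_le_exp.mpr h
      _ = Real.exp (y / (1 + y)) ^ n := Real.exp_nat_mul _ _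
      _ ≤ (1 + y) ^ n := by gcongr
  gcongr

/-- The limiting inequality `(1 - δ) e < s e ^ s` for `s = (1 - δ / 6) ^ 2`. -/
theorem HardCore.one_sub_mul_exp_one_lt {δ : ℝ} (h0 : 0 < δ) (h1 : δ < 1) :
    (1 - δ) * Real.exp 1 < (1 - δ / 6) ^ 2 * Real.exp ((1 - δ / 6) ^ 2) := by
  have hs : 1 - δ / 3 ≤ (1 - δ / 6) ^ 2 := by nlinarith
  have hexp : (1 - δ / 3) * Real.exp 1 ≤ Real.exp ((1 - δ / 6) ^ 2) := by
    have h := Real.add_one_le_exp (-(δ / 3))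
    calc (1 - δ / 3) * Real.exp 1 ≤ Real.exp (-(δ / 3)) * Real.exp 1 := by
          gcongr
          linarith
      _ = Real.exp (1 - δ / 3) := by
          rw [← Real.exp_add]
          ring_nf
      _ ≤ _ := Real.exp_le_exp.mpr hs
  calc (1 - δ) * Real.exp 1 < (1 - δ / 3) * (1 - δ / 3) * Real.exp 1 := by
        gcongr
        nlinarith
    _ = (1 - δ / 3) * ((1 - δ / 3) * Real.exp 1) := mul_assoc _ _ _
    _ ≤ _ := mul_le_mul hs hexp (by have := Real.exp_pos 1; nlinarith) (by positivity)

/-- For large `n`, the scaled fugacity `(1 - δ) * n * lambdaC n` stays below `s e ^ s`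
with `s = (1 - δ / 6) ^ 2`. -/
theorem HardCore.eventually_mul_lambdaC_lt {δ : ℝ} (h0 : 0 < δ) (h1 : δ < 1) :
    ∀ᶠ n : ℕ in atTop,
      (1 - δ) * ((n : ℝ) * lambdaC n) < (1 - δ / 6) ^ 2 * Real.exp ((1 - δ / 6) ^ 2) := by
  have hlim : Tendsto (fun n : ℕ ↦ (1 - δ) *
      ((n : ℝ) / (n + (-1)) * Real.exp ((n : ℝ) / (n + (-2))))) atTop
      (𝓝 ((1 - δ) * (1 * Real.exp 1))) :=
    ((tendsto_natCast_div_add_atTop (-1 : ℝ)).mul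
      ((Real.continuous_exp.tendsto 1).comp (tendsto_natCast_div_add_atTop (-2 : ℝ)))).const_mul _
  rw [one_mul] at hlim
  filter_upwards [hlim.eventually_lt_const (one_sub_mul_exp_one_lt h0 h1), eventually_ge_atTop 3]
    with n hlt hn
  exact (mul_le_mul_of_nonneg_left (natCast_mul_lambdaC_le hn) (by linarith)).trans_lt hlt

/-- Here `xhat` plays the role of the unique fixed point
`x̂(λ,Δ)` of `x ↦ (1+λx)^{-Δ}` in `[0,1]`, and
`α(λ,Δ) = √(Δ·λ·x̂ / (1+λ·x̂))`. -/
theorem alpha_le_uniqueness_condition :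
    ∀ δ : ℝ, 0 < δ →
    ∃ Δ₀ : ℕ, ∀ (Δ : ℕ) (lam : ℝ),
      Δ₀ ≤ Δ → 0 < lam → lam < (1 - δ) * lambdaC Δ →
      ∀ xhat : ℝ, xhat ∈ Set.Icc (0 : ℝ) 1 → xhat = ((1 + lam * xhat) ^ Δ)⁻¹ →
        Real.sqrt ((Δ : ℝ) * lam * xhat / (1 + lam * xhat)) ≤ 1 - δ / 6 := by
  intro δ hδ
  by_cases hδ1 : δ < 1
  · obtain ⟨N, hN⟩ := eventually_atTop.mp (eventually_mul_lambdaC_lt hδ hδ1)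
    refine ⟨max N 1, fun n lam hn hlam hlt x hx01 hfix ↦ ?_⟩
    have hn1 : (0 : ℝ) < n := by
      exact_mod_cast (le_max_right N 1).trans hn
    rw [Real.sqrt_le_left (by linarith)]
    by_contra! hlarge
    have hx : 0 < x := by
      have := hx01.1
      rw [hfix]
      positivity
    have hlower := mul_exp_le_mul_one_add_pow (n := n) (y := lam * x) (s := (1 - δ / 6) ^ 2)
      (by positivity) (by rw [← mul_assoc]; exact hlarge.le)
    have hpow : x * (1 + lam * x) ^ n = 1 := by
      have hne : (1 + lam * x) ^ n ≠ 0 := by positivity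
      calc x * (1 + lam * x) ^ n = ((1 + lam * x) ^ n)⁻¹ * (1 + lam * x) ^ n := by
            rw [← hfix]
        _ = 1 := inv_mul_cancel₀ hne
    have heq : (n : ℝ) * (lam * x) * (1 + lam * x) ^ n = n * lam := by
      linear_combination (n : ℝ) * lam * hpow
    have hupper := hN n ((le_max_left N 1).trans hn)
    have := mul_lt_mul_of_pos_left hlt hn1
    linarith
  · refine ⟨3, fun n lam hn hlam hlt ↦ ?_⟩
    have hn' : (3 : ℝ) ≤ n := by exact_mod_cast hn
    have hc : 0 ≤ lambdaC n :=
      div_nonneg (pow_nonneg (by linarith) _) (pow_nonneg (by linarith) _)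
    nlinarith
end
end

section
/- Let G=(V,E) be a finite graph with maximum degree at most Δ and let λ>0 satisfy α(λ,Δ) ≤ 1. Then for any ω∈[0,1]^V and any v∈V: √( λ·F(ω)(v) / (1+λ·F(ω)(v)) ) · Σ_{u∈N(v)} √( λ·ω(u) / (1+λ·ω(u)) ) ≤ α(λ,Δ). -/
open scoped BigOperators

noncomputable section

open HardCore

/-- AM-GM for a nonnegative family padded with ones up to `n` terms, where `m` is the mean. -/
theorem prod_le_pow_of_padded_mean {ι : Type*} (s : Finset ι) (f : ι → ℝ) (n : ℕ) (m : ℝ)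
    (hf : ∀ i ∈ s, 0 ≤ f i) (hm : 0 < m) (hn : s.card ≤ n)
    (hmean : ∑ i ∈ s, f i + ((n : ℝ) - s.card) = n * m) :
    ∏ i ∈ s, f i ≤ m ^ n := by
  have hprod : ∏ i ∈ s, f i / m ≤ Real.exp (∑ i ∈ s, (f i / m - 1)) := by
    rw [Real.exp_sum]
    refine Finset.prod_le_prod (fun i hi => div_nonneg (hf i hi) hm.le) fun i _ => ?_
    linarith [Real.add_one_le_exp (f i / m - 1)]
  have hpad : (m⁻¹) ^ (n - s.card) ≤ Real.exp (((n : ℝ) - s.card) * (m⁻¹ - 1)) := by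
    rw [← Nat.cast_sub hn, Real.exp_nat_mul]
    refine pow_le_pow_left₀ (by positivity) ?_ _
    linarith [Real.add_one_le_exp (m⁻¹ - 1)]
  have hexp : ∑ i ∈ s, (f i / m - 1) + ((n : ℝ) - s.card) * (m⁻¹ - 1) = 0 := by
    rw [Finset.sum_sub_distrib, ← Finset.sum_div, Finset.sum_const, nsmul_eq_mul]
    field_simp
    linarith
  have hmul := mul_le_mul hprod hpad (by positivity) (Real.exp_pos _).le
  rw [← Real.exp_add, hexp, Real.exp_zero, Finset.prod_div_distrib, Finset.prod_const,
    inv_pow, ← div_eq_mul_inv, div_div, ← pow_add, Nat.add_sub_cancel' hn,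
    div_le_one (by positivity)] at hmul
  exact hmul

/-- Two-weight AM-GM: `a ^ n * b ≤ c ^ (n + 1)` when the mean of `n` copies of `a` and one of `b`
is at most `c`. -/
theorem pow_mul_le_pow_succ_of_mean_le {a b c : ℝ} (n : ℕ) (ha : 0 < a) (hc : 0 ≤ c)
    (h : n * a + b ≤ (n + 1) * c) : a ^ n * b ≤ c ^ (n + 1) := by
  have hbern := one_add_mul_sub_le_pow (a := c / a) (by linarith [div_nonneg hc ha.le]) (n + 1)
  have hb : b / a ≤ 1 + ((n + 1 : ℕ) : ℝ) * (c / a - 1) := by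
    push_cast
    field_simp
    linarith
  have hle := hb.trans hbern
  rw [div_pow, div_le_div_iff₀ ha (by positivity)] at hle
  refine le_of_mul_le_mul_right ?_ ha
  calc a ^ n * b * a = b * a ^ (n + 1) := by ring
    _ ≤ _ := hle

/-- Replacing every `t i` by the padded mean `(∑ t i) / n` increases `∏ (1 - t i ^ 2)`. -/
theorem prod_one_sub_sq_le {ι : Type*} (s : Finset ι) (t : ι → ℝ) (n : ℕ) (hpos : 0 < n)
    (ht0 : ∀ i ∈ s, 0 ≤ t i) (ht1 : ∀ i ∈ s, t i ≤ 1) (hn : s.card ≤ n)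
    (hlt : (∑ i ∈ s, t i) / n < 1) :
    ∏ i ∈ s, (1 - t i ^ 2) ≤ (1 - ((∑ i ∈ s, t i) / n) ^ 2) ^ n := by
  have hn' : (0 : ℝ) < n := by exact_mod_cast hpos
  have hr : 0 ≤ (∑ i ∈ s, t i) / n := div_nonneg (Finset.sum_nonneg ht0) hn'.le
  have hminus : ∏ i ∈ s, (1 - t i) ≤ (1 - (∑ i ∈ s, t i) / n) ^ n := by
    refine prod_le_pow_of_padded_mean s _ n _ (fun i hi => by linarith [ht1 i hi])
      (by linarith) hn ?_
    simp only [Finset.sum_sub_distrib, Finset.sum_const, nsmul_eq_mul]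
    field_simp
    ring
  have hplus : ∏ i ∈ s, (1 + t i) ≤ (1 + (∑ i ∈ s, t i) / n) ^ n := by
    refine prod_le_pow_of_padded_mean s _ n _ (fun i hi => by linarith [ht0 i hi])
      (by linarith) hn ?_
    simp only [Finset.sum_add_distrib, Finset.sum_const, nsmul_eq_mul]
    field_simp
    ring
  calc ∏ i ∈ s, (1 - t i ^ 2) = (∏ i ∈ s, (1 - t i)) * ∏ i ∈ s, (1 + t i) := by
        rw [← Finset.prod_mul_distrib]
        exact Finset.prod_congr rfl fun i _ => by ring
    _ ≤ (1 - (∑ i ∈ s, t i) / n) ^ n * (1 + (∑ i ∈ s, t i) / n) ^ n :=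
        mul_le_mul hminus hplus (Finset.prod_nonneg fun i hi => by linarith [ht0 i hi])
          (pow_nonneg (by linarith) _)
    _ = _ := by rw [← mul_pow]; ring

/-- Here `xhat` plays the role of the unique fixed point
`x̂(λ,Δ)` of `x ↦ (1+λx)^{-Δ}` in `[0,1]`, and
`α(λ,Δ) = √(Δ·λ·x̂ / (1+λ·x̂))`; the hypothesis is `α(λ,Δ) ≤ 1`. -/
theorem bp_decay_multivariate_bound
    (V : Type) [Fintype V] [DecidableEq V] (G : SimpleGraph V) [DecidableRel G.Adj]
    (Δ : ℕ) (lam : ℝ) (xhat : ℝ)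
    (hΔpos : 0 < Δ) (hdeg : G.maxDegree ≤ Δ) (hlam : 0 < lam)
    (hx : xhat ∈ Set.Icc (0 : ℝ) 1) (hfix : xhat = ((1 + lam * xhat) ^ Δ)⁻¹)
    (halpha : Real.sqrt ((Δ : ℝ) * lam * xhat / (1 + lam * xhat)) ≤ 1) :
    ∀ ω : V → ℝ, (∀ u : V, ω u ∈ Set.Icc (0 : ℝ) 1) →
    ∀ v : V,
      Real.sqrt (lam * bpF G lam ω v / (1 + lam * bpF G lam ω v)) *
          ∑ u ∈ G.neighborFinset v, Real.sqrt (lam * ω u / (1 + lam * ω u))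
        ≤ Real.sqrt ((Δ : ℝ) * lam * xhat / (1 + lam * xhat)) := by
  intro ω hω v
  have hD : (0 : ℝ) < Δ := by exact_mod_cast hΔpos
  have hden : 0 < 1 + lam * xhat := by nlinarith [hx.1]
  have hω1 : ∀ u, 0 < 1 + lam * ω u := fun u => by nlinarith [(hω u).1]
  have hcard : (G.neighborFinset v).card ≤ Δ := by
    rw [G.card_neighborFinset_eq_degree]
    exact (G.degree_le_maxDegree v).trans hdeg
  set t : V → ℝ := fun u => Real.sqrt (lam * ω u / (1 + lam * ω u)) with ht
  have htsq : ∀ u, 1 - t u ^ 2 = (1 + lam * ω u)⁻¹ := fun u => by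
    rw [ht, Real.sq_sqrt (div_nonneg (mul_nonneg hlam.le (hω u).1) (hω1 u).le)]
    have := (hω1 u).ne'
    field_simp
    ring
  have ht0 : ∀ u, 0 ≤ t u := fun u => Real.sqrt_nonneg _
  have ht1 : ∀ u, t u < 1 := fun u => by
    have := inv_pos.2 (hω1 u)
    nlinarith [htsq u, ht0 u]
  have hS0 : 0 ≤ ∑ u ∈ G.neighborFinset v, t u := Finset.sum_nonneg fun u _ => ht0 u
  have hlt : (∑ u ∈ G.neighborFinset v, t u) / Δ < 1 := by
    rw [div_lt_one hD]
    rcases (G.neighborFinset v).eq_empty_or_nonempty with he | hne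
    · simpa [he] using hD
    · calc ∑ u ∈ G.neighborFinset v, t u < ∑ u ∈ G.neighborFinset v, 1 :=
            Finset.sum_lt_sum_of_nonempty hne fun u _ => ht1 u
        _ ≤ Δ := by simpa using hcard
  have hF : bpF G lam ω v ≤ (1 - ((∑ u ∈ G.neighborFinset v, t u) / Δ) ^ 2) ^ Δ := by
    have hjensen := prod_one_sub_sq_le (G.neighborFinset v) t Δ hΔpos (fun u _ => ht0 u)
      (fun u _ => (ht1 u).le) hcard hlt
    simpa only [bpF, htsq] using hjensen
  have hF0 : 0 ≤ bpF G lam ω v := Finset.prod_nonneg fun u _ => (inv_pos.2 (hω1 u)).le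
  have hSr : ∑ u ∈ G.neighborFinset v, t u = Δ * ((∑ u ∈ G.neighborFinset v, t u) / Δ) := by
    field_simp
  have hr0 : 0 ≤ (∑ u ∈ G.neighborFinset v, t u) / Δ := div_nonneg hS0 hD.le
  rw [hSr]
  generalize (∑ u ∈ G.neighborFinset v, t u) / Δ = r at *
  generalize bpF G lam ω v = F at *
  obtain ⟨p, hp⟩ : ∃ p, p = lam * xhat / (1 + lam * xhat) := ⟨_, rfl⟩
  have hp0 : 0 ≤ p := hp ▸ div_nonneg (mul_nonneg hlam.le hx.1) hden.le
  have hpinv : 1 - p = (1 + lam * xhat)⁻¹ := by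
    rw [hp]
    field_simp
    ring
  have hα : (Δ : ℝ) * lam * xhat / (1 + lam * xhat) = Δ * p := by
    rw [hp]
    ring
  rw [hα] at halpha ⊢
  have hDp : Δ * p ≤ 1 := by simpa using Real.sqrt_le_iff.1 halpha
  have hkey : lam * F * (Δ * r ^ 2 - p) ≤ p := by
    rcases le_or_gt (Δ * r ^ 2 - p) 0 with hneg | hposi
    · exact (mul_nonpos_of_nonneg_of_nonpos (mul_nonneg hlam.le hF0) hneg).trans hp0
    · have hamgm : (1 - r ^ 2) ^ Δ * (Δ * r ^ 2 - p) ≤ (1 - p) ^ (Δ + 1) :=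
        pow_mul_le_pow_succ_of_mean_le Δ (by nlinarith) (hpinv ▸ (inv_pos.2 hden).le)
          (by linarith)
      rw [pow_succ (1 - p), hpinv, inv_pow, ← hfix] at hamgm
      calc lam * F * (Δ * r ^ 2 - p) = lam * (F * (Δ * r ^ 2 - p)) := by ring
        _ ≤ lam * ((1 - r ^ 2) ^ Δ * (Δ * r ^ 2 - p)) := by gcongr
        _ ≤ lam * (xhat * (1 + lam * xhat)⁻¹) := by gcongr
        _ = p := by rw [hp]; ring
  have hA : 0 < 1 + lam * F := by nlinarith
  apply Real.le_sqrt_of_sq_le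
  rw [mul_pow, Real.sq_sqrt (div_nonneg (mul_nonneg hlam.le hF0) hA.le), div_mul_eq_mul_div,
    div_le_iff₀ hA]
  nlinarith [mul_le_mul_of_nonneg_left hkey hD.le]
end
end

section
/- For all δ>0 there exists Δ₀=Δ₀(δ) such that for every finite graph G=(V,E) with maximum degree Δ≥Δ₀, every 0<λ<(1−δ)·λ_c(Δ), any ω₁,ω₂ ∈ [0,1]^V and any v∈V: |Ψ(F(ω₁)(v)) − Ψ(F(ω₂)(v))| ≤ (1−δ/6)·max_{u∈N(v)} |Ψ(ω₁(u)) − Ψ(ω₂(u))|. -/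
open scoped BigOperators

noncomputable section

open HardCore

namespace HardCore

theorem mul_lambdaC_le (n : ℕ) (hn : 0 < n) :
    ((n + 2 : ℕ) : ℝ) * lambdaC (n + 2) ≤
      Real.exp 1 * (((n : ℝ) + 1) * ((n : ℝ) + 2) / (n : ℝ) ^ 2) := by
  have hn' : (0 : ℝ) < n := by exact_mod_cast hn
  have key : (1 + 1 / (n : ℝ)) ^ n ≤ Real.exp 1 := by
    have h : 1 + 1 / (n : ℝ) ≤ Real.exp (1 / n) := by
      linarith [Real.add_one_le_exp (1 / (n : ℝ))]
    calc (1 + 1 / (n : ℝ)) ^ n ≤ Real.exp (1 / n) ^ n := by gcongr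
      _ = Real.exp 1 := by
        rw [← Real.exp_nat_mul]
        congr 1
        field_simp
  have e : ((n + 2 : ℕ) : ℝ) * lambdaC (n + 2) =
      (1 + 1 / (n : ℝ)) ^ n * (((n : ℝ) + 1) * ((n : ℝ) + 2) / (n : ℝ) ^ 2) := by
    have h1 : ((n + 2 : ℕ) : ℝ) - 1 = n + 1 := by push_cast; ring
    have h2 : ((n + 2 : ℕ) : ℝ) - 2 = n := by push_cast; ring
    have h3 : 1 + 1 / (n : ℝ) = (n + 1) / n := by field_simp
    rw [lambdaC, h1, h2, h3, div_pow, show n + 2 - 1 = n + 1 from rfl]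
    push_cast
    field_simp
    ring
  rw [e]
  gcongr

/-- Below criticality, `Δ * lam / e` is at most `(1 - δ / 6) ^ 2` once `Δ` is large. -/
theorem mul_le_of_lt_lambdaC {δ : ℝ} (h0 : 0 < δ) (h1 : δ < 1) {n : ℕ} (hn : 8 / δ ≤ n)
    {lam : ℝ} (hlam : lam < (1 - δ) * lambdaC (n + 2)) :
    lam * ((n + 2 : ℕ) : ℝ) ≤ (1 - δ / 6) ^ 2 * Real.exp 1 := by
  have hn8 : 8 ≤ δ * n := by
    rw [div_le_iff₀ h0] at hn
    linarith
  have hnR : (8 : ℝ) ≤ n := by nlinarith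
  have hn0 : 0 < n := by
    have : (0 : ℝ) < n := by linarith
    exact_mod_cast this
  have hratio : (1 - δ) * (((n : ℝ) + 1) * ((n : ℝ) + 2) / (n : ℝ) ^ 2) ≤ (1 - δ / 6) ^ 2 := by
    have : ((n : ℝ) + 1) * ((n : ℝ) + 2) / (n : ℝ) ^ 2 ≤ 1 + 2 * δ / 3 := by
      rw [div_le_iff₀ (by positivity)]
      nlinarith
    calc _ ≤ (1 - δ) * (1 + 2 * δ / 3) := mul_le_mul_of_nonneg_left this (by linarith)
      _ ≤ (1 - δ / 6) ^ 2 := by nlinarith [sq_nonneg δ]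
  calc lam * ((n + 2 : ℕ) : ℝ) ≤ (1 - δ) * lambdaC (n + 2) * ((n + 2 : ℕ) : ℝ) := by gcongr
    _ = (1 - δ) * (((n + 2 : ℕ) : ℝ) * lambdaC (n + 2)) := by ring
    _ ≤ (1 - δ) * (Real.exp 1 * (((n : ℝ) + 1) * ((n : ℝ) + 2) / (n : ℝ) ^ 2)) :=
        mul_le_mul_of_nonneg_left (mul_lambdaC_le n hn0) (by linarith)
    _ = (1 - δ) * (((n : ℝ) + 1) * ((n : ℝ) + 2) / (n : ℝ) ^ 2) * Real.exp 1 := by ring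
    _ ≤ _ := by gcongr

theorem tanh_sq_le_two_mul_log_cosh (y : ℝ) :
    Real.tanh y ^ 2 ≤ 2 * Real.log (Real.cosh y) := by
  have hc := Real.cosh_pos y
  have h := Real.log_le_sub_one_of_pos (x := (Real.cosh y ^ 2)⁻¹) (by positivity)
  rw [Real.log_inv, Real.log_pow] at h
  have ht : Real.tanh y ^ 2 = 1 - (Real.cosh y ^ 2)⁻¹ := by
    rw [Real.tanh_eq_sinh_div_cosh, div_pow, Real.sinh_sq]
    field_simp
  push_cast at h
  linarith

theorem hasDerivAt_log_cosh (y : ℝ) :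
    HasDerivAt (fun x => Real.log (Real.cosh x)) (Real.tanh y) y := by
  rw [Real.tanh_eq_sinh_div_cosh]
  exact (Real.hasDerivAt_cosh y).log (Real.cosh_pos y).ne'

/-- The `ℓ¹`-norm bound for the gradient of belief propagation in the `arsinh` coordinates. -/
theorem sqrt_mul_exp_mul_sum_abs_tanh_le {ι : Type*} (s : Finset ι) {lam c D : ℝ} (hlam : 0 ≤ lam)
    (hc : 0 ≤ c) (hs : (s.card : ℝ) ≤ D) (h : lam * D ≤ c ^ 2 * Real.exp 1) (y : ι → ℝ) :
    Real.sqrt lam * Real.exp (-∑ u ∈ s, Real.log (Real.cosh (y u))) *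
      ∑ u ∈ s, |Real.tanh (y u)| ≤ c := by
  refine abs_le_of_sq_le_sq' ?_ hc |>.2
  set T := ∑ u ∈ s, Real.tanh (y u) ^ 2 with hT
  have hT0 : 0 ≤ T := Finset.sum_nonneg fun _ _ => sq_nonneg _
  have hcs : (∑ u ∈ s, |Real.tanh (y u)|) ^ 2 ≤ D * T := by
    calc _ ≤ s.card * ∑ u ∈ s, |Real.tanh (y u)| ^ 2 := sq_sum_le_card_mul_sum_sq
      _ = s.card * T := by simp only [sq_abs, hT]
      _ ≤ D * T := by gcongr
  have hexp : Real.exp (-∑ u ∈ s, Real.log (Real.cosh (y u))) ^ 2 ≤ Real.exp (-T) := by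
    rw [← Real.exp_nat_mul]
    apply Real.exp_le_exp.2
    have : T ≤ 2 * ∑ u ∈ s, Real.log (Real.cosh (y u)) := by
      rw [Finset.mul_sum]
      exact Finset.sum_le_sum fun u _ => tanh_sq_le_two_mul_log_cosh (y u)
    push_cast
    linarith
  have hmax : Real.exp 1 * (T * Real.exp (-T)) ≤ 1 := by
    have h1 : T ≤ Real.exp (T - 1) := by linarith [Real.add_one_le_exp (T - 1)]
    calc Real.exp 1 * (T * Real.exp (-T))
        ≤ Real.exp 1 * (Real.exp (T - 1) * Real.exp (-T)) := by gcongr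
      _ = 1 := by
        rw [← Real.exp_add, ← Real.exp_add, ← Real.exp_zero]
        congr 1
        ring
  calc _ = lam * (Real.exp (-∑ u ∈ s, Real.log (Real.cosh (y u))) ^ 2 *
          (∑ u ∈ s, |Real.tanh (y u)|) ^ 2) := by
        rw [mul_pow, mul_pow, Real.sq_sqrt hlam]
        ring
    _ ≤ lam * (Real.exp (-T) * (D * T)) := by gcongr
    _ = lam * D * (T * Real.exp (-T)) := by ring
    _ ≤ c ^ 2 * Real.exp 1 * (T * Real.exp (-T)) := by gcongr
    _ = c ^ 2 * (Real.exp 1 * (T * Real.exp (-T))) := by ring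
    _ ≤ c ^ 2 := mul_le_of_le_one_right (sq_nonneg c) hmax

/-- Belief propagation in the `arsinh` coordinates is `c`-Lipschitz for the sup norm. -/
theorem abs_arsinh_sub_arsinh_le {ι : Type*} (s : Finset ι) {lam c D M : ℝ} (hlam : 0 ≤ lam)
    (hc : 0 ≤ c) (hM : 0 ≤ M) (hs : (s.card : ℝ) ≤ D) (h : lam * D ≤ c ^ 2 * Real.exp 1)
    (y z : ι → ℝ) (hyz : ∀ u ∈ s, |y u - z u| ≤ M) :
    |Real.arsinh (Real.sqrt lam * Real.exp (-∑ u ∈ s, Real.log (Real.cosh (y u)))) -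
      Real.arsinh (Real.sqrt lam * Real.exp (-∑ u ∈ s, Real.log (Real.cosh (z u))))| ≤ c * M := by
  let w : ℝ → ι → ℝ := fun t u => z u + t * (y u - z u)
  let q : ℝ → ℝ := fun t => Real.sqrt lam * Real.exp (-∑ u ∈ s, Real.log (Real.cosh (w t u)))
  have hderiv (t : ℝ) : HasDerivAt (fun t => Real.arsinh (q t))
      ((Real.sqrt (1 + q t ^ 2))⁻¹ • (Real.sqrt lam *
        (Real.exp (-∑ u ∈ s, Real.log (Real.cosh (w t u))) *
          -∑ u ∈ s, Real.tanh (w t u) * (y u - z u)))) t := by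
    have hw (u : ι) : HasDerivAt (fun t => w t u) (y u - z u) t := by
      simpa [w] using ((hasDerivAt_id t).mul_const (y u - z u)).const_add (z u)
    have hsum : HasDerivAt (fun t => ∑ u ∈ s, Real.log (Real.cosh (w t u)))
        (∑ u ∈ s, Real.tanh (w t u) * (y u - z u)) t :=
      HasDerivAt.fun_sum fun u _ =>
        HasDerivAt.comp (h₂ := fun x => Real.log (Real.cosh x)) t
          (hasDerivAt_log_cosh (w t u)) (hw u)
    exact (hsum.fun_neg.exp.const_mul (Real.sqrt lam)).arsinh
  have hbound (t : ℝ) : ‖(Real.sqrt (1 + q t ^ 2))⁻¹ • (Real.sqrt lam *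
        (Real.exp (-∑ u ∈ s, Real.log (Real.cosh (w t u))) *
          -∑ u ∈ s, Real.tanh (w t u) * (y u - z u)))‖ ≤ c * M := by
    have h1 : (Real.sqrt (1 + q t ^ 2))⁻¹ ≤ 1 :=
      inv_le_one_of_one_le₀ (Real.one_le_sqrt.2 (by linarith [sq_nonneg (q t)]))
    have h2 : |∑ u ∈ s, Real.tanh (w t u) * (y u - z u)| ≤
        (∑ u ∈ s, |Real.tanh (w t u)|) * M := by
      rw [Finset.sum_mul]
      refine (Finset.abs_sum_le_sum_abs _ _).trans (Finset.sum_le_sum fun u hu => ?_)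
      rw [abs_mul]
      exact mul_le_mul_of_nonneg_left (hyz u hu) (abs_nonneg _)
    rw [norm_smul, Real.norm_of_nonneg (by positivity), Real.norm_eq_abs, abs_mul, abs_mul,
      abs_neg, abs_of_nonneg (Real.sqrt_nonneg lam), Real.abs_exp]
    refine (mul_le_of_le_one_left (by positivity) h1).trans ?_
    calc _ ≤ Real.sqrt lam * (Real.exp (-∑ u ∈ s, Real.log (Real.cosh (w t u))) *
          ((∑ u ∈ s, |Real.tanh (w t u)|) * M)) := by gcongr
      _ = Real.sqrt lam * Real.exp (-∑ u ∈ s, Real.log (Real.cosh (w t u))) *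
          (∑ u ∈ s, |Real.tanh (w t u)|) * M := by ring
      _ ≤ c * M := by
        gcongr
        exact sqrt_mul_exp_mul_sum_abs_tanh_le s hlam hc hs h (w t)
  have := norm_image_sub_le_of_norm_deriv_le_segment_01'
    (fun t _ => (hderiv t).hasDerivWithinAt) (fun t _ => hbound t)
  simpa [q, w] using this

theorem arsinh_sqrt_mul_bpF {V : Type} [Fintype V] [DecidableEq V] (G : SimpleGraph V)
    [DecidableRel G.Adj] {lam : ℝ} (hlam : 0 ≤ lam) {ω : V → ℝ} (hω : ∀ u, 0 ≤ ω u) (v : V) :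
    Real.arsinh (Real.sqrt (lam * bpF G lam ω v)) =
      Real.arsinh (Real.sqrt lam * Real.exp (-∑ u ∈ G.neighborFinset v,
        Real.log (Real.cosh (Real.arsinh (Real.sqrt (lam * ω u)))))) := by
  congr 1
  rw [Real.sqrt_mul hlam]
  congr 1
  rw [← Finset.sum_neg_distrib, Real.exp_sum, bpF, Real.sqrt_eq_iff_mul_self_eq
    (Finset.prod_nonneg fun u _ => inv_nonneg.2 (by have := mul_nonneg hlam (hω u); linarith))
    (Finset.prod_nonneg fun _ _ => (Real.exp_pos _).le), ← Finset.prod_mul_distrib]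
  refine Finset.prod_congr rfl fun u _ => ?_
  have h0 := mul_nonneg hlam (hω u)
  rw [Real.exp_neg, Real.exp_log (Real.cosh_pos _), Real.cosh_arsinh, Real.sq_sqrt h0, ← mul_inv,
    Real.mul_self_sqrt (by linarith)]

theorem lambdaC_nonneg {D : ℕ} (hD : 2 ≤ D) : 0 ≤ lambdaC D := by
  have h : (2 : ℝ) ≤ D := by exact_mod_cast hD
  exact div_nonneg (pow_nonneg (by linarith) _) (pow_nonneg (by linarith) _)

end HardCore

theorem psi_potential_contraction :
    ∀ δ : ℝ, 0 < δ →
    ∃ Δ₀ : ℕ,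
      ∀ (V : Type) [Fintype V] [DecidableEq V] (G : SimpleGraph V) [DecidableRel G.Adj]
        (Δ : ℕ) (lam : ℝ),
        G.maxDegree = Δ → Δ₀ ≤ Δ →
        0 < lam → lam < (1 - δ) * lambdaC Δ →
        ∀ ω₁ ω₂ : V → ℝ,
          (∀ u : V, ω₁ u ∈ Set.Icc (0 : ℝ) 1) → (∀ u : V, ω₂ u ∈ Set.Icc (0 : ℝ) 1) →
        ∀ v : V,
          |Psi lam (bpF G lam ω₁ v) - Psi lam (bpF G lam ω₂ v)| ≤
            (1 - δ / 6) *
              sSup ((fun u => |Psi lam (ω₁ u) - Psi lam (ω₂ u)|) '' {u : V | G.Adj v u}) := by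
  intro δ hδ
  refine ⟨⌈8 / δ⌉₊ + 2, ?_⟩
  intro V _ _ G _ Δ lam hdeg hΔ hlam hlt ω₁ ω₂ hω₁ hω₂ v
  have hδ1 : δ < 1 := by
    by_contra! hge
    have := mul_nonneg (sub_nonneg.2 hge) (lambdaC_nonneg (D := Δ) (by omega))
    linarith
  obtain ⟨n, rfl⟩ : ∃ n, Δ = n + 2 := ⟨Δ - 2, by omega⟩
  have hn : 8 / δ ≤ n := Nat.ceil_le.1 (by omega)
  have hcrit := mul_le_of_lt_lambdaC hδ hδ1 hn hlt
  have hcard : ((G.neighborFinset v).card : ℝ) ≤ ((n + 2 : ℕ) : ℝ) := by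
    rw [G.card_neighborFinset_eq_degree, ← hdeg]
    exact_mod_cast G.degree_le_maxDegree v
  have hsqrt : 0 < Real.sqrt lam := Real.sqrt_pos.2 hlam
  have hPsi (a b : ℝ) : |Psi lam a - Psi lam b| = (Real.sqrt lam)⁻¹ *
      |Real.arsinh (Real.sqrt (lam * a)) - Real.arsinh (Real.sqrt (lam * b))| := by
    rw [Psi, Psi, ← mul_sub, abs_mul, abs_of_pos (inv_pos.2 hsqrt)]
  set M := sSup ((fun u => |Psi lam (ω₁ u) - Psi lam (ω₂ u)|) '' {u : V | G.Adj v u})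
  have hM0 : 0 ≤ M := Real.sSup_nonneg (by rintro _ ⟨u, _, rfl⟩; exact abs_nonneg _)
  have hM (u : V) (hu : u ∈ G.neighborFinset v) :
      |Real.arsinh (Real.sqrt (lam * ω₁ u)) - Real.arsinh (Real.sqrt (lam * ω₂ u))| ≤
        Real.sqrt lam * M := by
    have hle : |Psi lam (ω₁ u) - Psi lam (ω₂ u)| ≤ M :=
      le_csSup (Set.toFinite _).bddAbove ⟨u, by simpa using hu, rfl⟩
    rwa [hPsi, inv_mul_le_iff₀ hsqrt] at hle
  rw [hPsi, inv_mul_le_iff₀ hsqrt, arsinh_sqrt_mul_bpF G hlam.le (fun u => (hω₁ u).1),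
    arsinh_sqrt_mul_bpF G hlam.le (fun u => (hω₂ u).1), mul_left_comm]
  exact abs_arsinh_sub_arsinh_le _ hlam.le (by linarith) (mul_nonneg hsqrt.le hM0) hcard hcrit
    _ _ hM
end
end
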